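/- There exist absolute constants c > 0, K ≥ 1 and c0 > 0 such that for every prime p and every finite set A ⊆ F_p with |A| < sqrt(p), one has max{ Sid^×_K(A), Sid^×_K(A+1) } ≥ c0·|A|^{1/2 + c}, where A + 1 = {a + 1 : a ∈ A}. -/

import Mathlib

open scoped BigOperators

/-- The number of pairs `(x, y) ∈ S × S` with `x = lam * y`. -/
noncomputable def mulPairCount {F : Type*} [Mul F] (lam : F) (S : Finset F) : ℕ :=
  Set.ncard {q : F × F | q.1 ∈ S ∧ q.2 ∈ S ∧ q.1 = lam * q.2}

/-- `S` is multiplicatively `K`-Sidon: for every `lam ≠ 1` the number of pairs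
`(x, y) ∈ S × S` with `x = lam * y` is at most `K`. -/
def IsMulSidon {F : Type*} [MulOneClass F] (K : ℝ) (S : Finset F) : Prop :=
  ∀ lam : F, lam ≠ 1 → (mulPairCount lam S : ℝ) ≤ K


namespace SP
open Finset
open scoped Pointwise

lemma drc {ι β : Type*} [DecidableEq ι] [DecidableEq β] (W : Finset ι) (B : Finset β)
    (E : ι → Finset β) (hE : ∀ w ∈ W, E w ⊆ B) (L : ℝ) (hL : 1 ≤ L) (hB : B.Nonempty)
    (hW : W.Nonempty) (h : ∀ w ∈ W, (B.card : ℝ) ≤ L * (E w).card) :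
    ∃ V ⊆ W, (W.card : ℝ) ≤ 4 * L * V.card ∧ ∀ v1 ∈ V, ∀ v2 ∈ V,
      ∃ U ⊆ W, (W.card : ℝ) ≤ 4 * L * U.card ∧
        ∀ w ∈ U, (B.card : ℝ) ≤ 32 * L ^ 2 * (E v1 ∩ E w).card ∧
          (B.card : ℝ) ≤ 32 * L ^ 2 * (E v2 ∩ E w).card := by
  classical
  have hBpos : (0 : ℝ) < B.card := by exact_mod_cast hB.card_pos
  have hWpos : (0 : ℝ) < W.card := by exact_mod_cast hW.card_pos
  have hLpos : (0 : ℝ) < L := by linarith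
  set bad : ι × ι → Prop := fun q => ¬ ((B.card : ℝ) ≤ 32 * L ^ 2 * (E q.1 ∩ E q.2).card) with hbad
  set Wb : β → Finset ι := fun b => W.filter (fun w => b ∈ E w) with hWb
  set bd : β → Finset (ι × ι) := fun b => (Wb b ×ˢ Wb b).filter bad with hbd
  have h1 : ∑ b ∈ B, ((Wb b).card : ℝ) = ∑ w ∈ W, ((E w).card : ℝ) := by
    have : ∀ b, ((Wb b).card : ℝ) = ∑ w ∈ W, if b ∈ E w then (1 : ℝ) else 0 := by
      intro b; simp [hWb]
    simp_rw [this]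
    rw [Finset.sum_comm]
    refine Finset.sum_congr rfl fun w hw => ?_
    rw [← Finset.sum_filter]
    simp
    congr 1
    ext b
    simp
    exact fun hb => hE w hw hb
  have h2 : (W.card : ℝ) * B.card ≤ L * ∑ b ∈ B, ((Wb b).card : ℝ) := by
    rw [h1, Finset.mul_sum]
    calc (W.card : ℝ) * B.card = ∑ w ∈ W, (B.card : ℝ) := by simp
      _ ≤ _ := Finset.sum_le_sum h
  have h3 : (∑ b ∈ B, ((Wb b).card : ℝ)) ^ 2 ≤ B.card * ∑ b ∈ B, ((Wb b).card : ℝ) ^ 2 :=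
    sq_sum_le_card_mul_sum_sq
  have h4 : ∑ b ∈ B, ((bd b).card : ℝ) =
      ∑ q ∈ (W ×ˢ W).filter bad, ((E q.1 ∩ E q.2).card : ℝ) := by
    have : ∀ b, ((bd b).card : ℝ) =
        ∑ q ∈ (W ×ˢ W).filter bad, if b ∈ E q.1 ∩ E q.2 then (1 : ℝ) else 0 := by
      intro b
      rw [← Finset.sum_filter]
      simp
      congr 1
      ext q
      simp [hbd, hWb]
      tauto
    simp_rw [this]
    rw [Finset.sum_comm]
    refine Finset.sum_congr rfl fun q hq => ?_
    rw [← Finset.sum_filter]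
    simp
    congr 1
    ext b
    simp at hq ⊢
    exact fun hb _ => hE _ hq.1.1 hb
  have h5 : 32 * L ^ 2 * ∑ b ∈ B, ((bd b).card : ℝ) ≤ W.card ^ 2 * B.card := by
    rw [h4, Finset.mul_sum]
    calc _ ≤ ∑ q ∈ (W ×ˢ W).filter bad, (B.card : ℝ) := by
          refine Finset.sum_le_sum fun q hq => ?_
          simp only [Finset.mem_filter, hbad] at hq
          exact (not_le.1 hq.2).le
      _ = ((W ×ˢ W).filter bad).card * (B.card : ℝ) := by simp
      _ ≤ (W ×ˢ W).card * (B.card : ℝ) := by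
          gcongr
          exact Finset.filter_subset _ _
      _ = _ := by simp [sq]
  have h6 : (W.card : ℝ) ^ 2 * B.card ≤ L ^ 2 * ∑ b ∈ B, ((Wb b).card : ℝ) ^ 2 := by
    have h7 : ((W.card : ℝ) * B.card) ^ 2 ≤ (L * ∑ b ∈ B, ((Wb b).card : ℝ)) ^ 2 := by
      gcongr
    have h8 : ((W.card : ℝ) ^ 2 * B.card) * B.card ≤
        (L ^ 2 * ∑ b ∈ B, ((Wb b).card : ℝ) ^ 2) * B.card := by
      calc _ = ((W.card : ℝ) * B.card) ^ 2 := by ring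
        _ ≤ _ := h7
        _ = L ^ 2 * (∑ b ∈ B, ((Wb b).card : ℝ)) ^ 2 := by ring
        _ ≤ L ^ 2 * (B.card * ∑ b ∈ B, ((Wb b).card : ℝ) ^ 2) := by gcongr
        _ = _ := by ring
    exact le_of_mul_le_mul_right h8 hBpos
  obtain ⟨b, hb, hb2⟩ : ∃ b ∈ B, (W.card : ℝ) ^ 2 ≤
      2 * L ^ 2 * (((Wb b).card : ℝ) ^ 2 - 16 * (bd b).card) := by
    apply Finset.exists_le_of_sum_le hB
    rw [← Finset.mul_sum, Finset.sum_sub_distrib, ← Finset.mul_sum]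
    simp
    nlinarith
  set N := (Wb b).card with hN
  have hbdnn : (0 : ℝ) ≤ (bd b).card := by positivity
  have hN1 : (W.card : ℝ) ≤ 2 * L * N := by
    have : (W.card : ℝ) ^ 2 ≤ (2 * L * N) ^ 2 := by nlinarith [sq_nonneg (L * N), sq_nonneg L]
    exact le_of_sq_le_sq this (by positivity)
  have hbdN : 16 * ((bd b).card : ℝ) ≤ (N : ℝ) ^ 2 := by
    by_contra hc
    push Not at hc
    have : 2 * L ^ 2 * (((Wb b).card : ℝ) ^ 2 - 16 * (bd b).card) < 0 := by
      apply mul_neg_of_pos_of_neg (by positivity)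
      rw [← hN]; linarith
    nlinarith [sq_nonneg (W.card : ℝ)]
  have hNpos : (0 : ℝ) < N := by
    by_contra hc
    push Not at hc
    nlinarith
  set bw : ι → Finset ι := fun w => (Wb b).filter (fun w' => bad (w, w')) with hbw
  set V := (Wb b).filter (fun w => 4 * ((bw w).card : ℝ) ≤ N) with hV
  have hcount : ((bd b).card : ℝ) = ∑ w ∈ Wb b, ((bw w).card : ℝ) := by
    simp only [hbd, hbw, Finset.card_filter, Finset.sum_product]
    push_cast
    rfl
  have hVc : 3 * (N : ℝ) ≤ 4 * V.card := by
    have e1 : ((Wb b).filter (fun w => ¬ 4 * ((bw w).card : ℝ) ≤ N)).card * (N : ℝ) ≤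
        4 * (bd b).card := by
      rw [hcount, Finset.mul_sum]
      calc _ = ∑ w ∈ (Wb b).filter (fun w => ¬ 4 * ((bw w).card : ℝ) ≤ N), (N : ℝ) := by simp
        _ ≤ ∑ w ∈ (Wb b).filter (fun w => ¬ 4 * ((bw w).card : ℝ) ≤ N), 4 * ((bw w).card : ℝ) := by
            refine Finset.sum_le_sum fun w hw => ?_
            simp at hw
            exact hw.2.le
        _ ≤ _ := Finset.sum_le_sum_of_subset_of_nonneg (Finset.filter_subset _ _)
            (fun _ _ _ => by positivity)
    have e2 : V.card + ((Wb b).filter (fun w => ¬ 4 * ((bw w).card : ℝ) ≤ N)).card = N := by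
      rw [hV, hN]; exact Finset.card_filter_add_card_filter_not _
    have e2' : (V.card : ℝ) + ((Wb b).filter (fun w => ¬ 4 * ((bw w).card : ℝ) ≤ N)).card = N := by
      exact_mod_cast e2
    nlinarith
  refine ⟨V, (Finset.filter_subset _ _).trans (Finset.filter_subset _ _), ?_, ?_⟩
  · nlinarith
  · intro v1 hv1 v2 hv2
    refine ⟨(Wb b) \ (bw v1 ∪ bw v2), Finset.sdiff_subset.trans (Finset.filter_subset _ _), ?_, ?_⟩
    · have e1 : N ≤ ((Wb b) \ (bw v1 ∪ bw v2)).card + (bw v1 ∪ bw v2).card := by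
        have := Finset.le_card_sdiff (bw v1 ∪ bw v2) (Wb b)
        omega
      have e2 := Finset.card_union_le (bw v1) (bw v2)
      have e3 : (N : ℝ) ≤ ((Wb b) \ (bw v1 ∪ bw v2)).card + ((bw v1).card + (bw v2).card) := by
        exact_mod_cast e1.trans (by omega)
      have e4 := (Finset.mem_filter.1 hv1).2
      have e5 := (Finset.mem_filter.1 hv2).2
      nlinarith
    · intro w hw
      simp only [Finset.mem_sdiff, Finset.mem_union, not_or, hbw, Finset.mem_filter, not_and,
        hbad, not_not] at hw
      exact ⟨hw.2.1 hw.1, hw.2.2 hw.1⟩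

end SP

namespace SP
open Finset
open scoped Pointwise

/-- number of `b ∈ B` with `l * b ∈ B`. -/
noncomputable def mr {p : ℕ} (B : Finset (ZMod p)) (l : ZMod p) : ℕ :=
  (B.filter (fun b => l * b ∈ B)).card

/-- number of `b ∈ B` with `b + d ∈ B`. -/
noncomputable def ar {p : ℕ} (B : Finset (ZMod p)) (d : ZMod p) : ℕ :=
  (B.filter (fun b => b + d ∈ B)).card

open Classical in
/-- multiplicative symmetry set. -/
noncomputable def MS {p : ℕ} [Fact p.Prime] (L : ℝ) (B : Finset (ZMod p)) : Finset (ZMod p) :=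
  univ.filter (fun l => l ≠ 0 ∧ (B.card : ℝ) ≤ L * mr B l)

open Classical in
/-- additive symmetry set. -/
noncomputable def AS {p : ℕ} [Fact p.Prime] (L : ℝ) (B : Finset (ZMod p)) : Finset (ZMod p) :=
  univ.filter (fun d => (B.card : ℝ) ≤ L * ar B d)

lemma mem_MS {p : ℕ} [Fact p.Prime] {L : ℝ} {B : Finset (ZMod p)} {l : ZMod p} :
    l ∈ MS L B ↔ l ≠ 0 ∧ (B.card : ℝ) ≤ L * mr B l := by
  simp [MS]

lemma mem_AS {p : ℕ} [Fact p.Prime] {L : ℝ} {B : Finset (ZMod p)} {l : ZMod p} :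
    l ∈ AS L B ↔ (B.card : ℝ) ≤ L * ar B l := by
  simp [AS]

lemma MS_mono {p : ℕ} [Fact p.Prime] {L L' : ℝ} (h : L ≤ L') (B : Finset (ZMod p)) :
    MS L B ⊆ MS L' B := by
  intro l hl
  rw [mem_MS] at *
  refine ⟨hl.1, hl.2.trans ?_⟩
  gcongr

lemma AS_mono {p : ℕ} [Fact p.Prime] {L L' : ℝ} (h : L ≤ L') (B : Finset (ZMod p)) :
    AS L B ⊆ AS L' B := by
  intro l hl
  rw [mem_AS] at *
  refine hl.trans ?_
  gcongr

lemma sum_mr_le {p : ℕ} [Fact p.Prime] (B : Finset (ZMod p)) (h0 : (0 : ZMod p) ∉ B)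
    (X : Finset (ZMod p)) : ∑ l ∈ X, mr B l ≤ B.card ^ 2 := by
  have : ∑ l ∈ X, mr B l = (X.sigma (fun l => B.filter (fun b => l * b ∈ B))).card := by
    simp [mr]
  rw [this, sq, ← Finset.card_product]
  apply Finset.card_le_card_of_injOn (fun q => (q.2, q.1 * q.2))
  · intro q hq
    simp at hq ⊢
    exact hq.2
  · rintro ⟨a, b⟩ hq ⟨c, d⟩ hr h
    simp at hq hr h ⊢
    obtain ⟨rfl, h⟩ := h
    have : b ≠ 0 := fun hb => h0 (hb ▸ hq.2.1)
    exact ⟨mul_right_cancel₀ this h, rfl⟩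

lemma sum_ar_le {p : ℕ} [Fact p.Prime] (B : Finset (ZMod p))
    (X : Finset (ZMod p)) : ∑ l ∈ X, ar B l ≤ B.card ^ 2 := by
  have : ∑ l ∈ X, ar B l = (X.sigma (fun l => B.filter (fun b => b + l ∈ B))).card := by
    simp [ar]
  rw [this, sq, ← Finset.card_product]
  apply Finset.card_le_card_of_injOn (fun q => (q.2, q.2 + q.1))
  · intro q hq
    simp at hq ⊢
    exact hq.2
  · rintro ⟨a, b⟩ hq ⟨c, d⟩ hr h
    simp at hq hr h ⊢
    obtain ⟨rfl, h⟩ := h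
    exact ⟨add_left_cancel h, rfl⟩

lemma card_MS_le {p : ℕ} [Fact p.Prime] {L : ℝ} (hL : 0 ≤ L) (B : Finset (ZMod p))
    (h0 : (0 : ZMod p) ∉ B) (hB : B.Nonempty) : ((MS L B).card : ℝ) ≤ L * B.card := by
  have hBpos : (0 : ℝ) < B.card := by exact_mod_cast hB.card_pos
  have h1 : ((∑ l ∈ MS L B, mr B l : ℕ) : ℝ) ≤ (B.card : ℝ) ^ 2 := by
    exact_mod_cast sum_mr_le B h0 (MS L B)
  have h2 : ((MS L B).card : ℝ) * B.card ≤ L * ((∑ l ∈ MS L B, mr B l : ℕ) : ℝ) := by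
    push_cast
    rw [Finset.mul_sum]
    calc ((MS L B).card : ℝ) * B.card = ∑ l ∈ MS L B, (B.card : ℝ) := by simp
      _ ≤ _ := Finset.sum_le_sum fun l hl => (mem_MS.1 hl).2
  nlinarith

lemma card_AS_le {p : ℕ} [Fact p.Prime] {L : ℝ} (hL : 0 ≤ L) (B : Finset (ZMod p))
    (hB : B.Nonempty) : ((AS L B).card : ℝ) ≤ L * B.card := by
  have hBpos : (0 : ℝ) < B.card := by exact_mod_cast hB.card_pos
  have h1 : ((∑ l ∈ AS L B, ar B l : ℕ) : ℝ) ≤ (B.card : ℝ) ^ 2 := by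
    exact_mod_cast sum_ar_le B (AS L B)
  have h2 : ((AS L B).card : ℝ) * B.card ≤ L * ((∑ l ∈ AS L B, ar B l : ℕ) : ℝ) := by
    push_cast
    rw [Finset.mul_sum]
    calc ((AS L B).card : ℝ) * B.card = ∑ l ∈ AS L B, (B.card : ℝ) := by simp
      _ ≤ _ := Finset.sum_le_sum fun l hl => (mem_AS.1 hl)
  nlinarith

lemma zero_mem_AS {p : ℕ} [Fact p.Prime] {L : ℝ} (hL : 1 ≤ L) (B : Finset (ZMod p)) :
    0 ∈ AS L B := by
  rw [mem_AS]
  have : ar B 0 = B.card := by simp [ar]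
  rw [this]
  nlinarith [(Nat.cast_nonneg B.card : (0:ℝ) ≤ B.card)]

lemma bsg_mul {p : ℕ} [Fact p.Prime] {L : ℝ} (hL : 1 ≤ L) (B : Finset (ZMod p))
    (hB : B.Nonempty) (W : Finset (ZMod p)) (hWL : W ⊆ MS L B) (hW : W.Nonempty) :
    ∃ V ⊆ W, (W.card : ℝ) ≤ 4 * L * V.card ∧
      ((V / V).card : ℝ) * W.card ≤ 4 * L * ((MS (32 * L ^ 2) B).card : ℝ) ^ 2 := by
  classical
  obtain ⟨V, hVW, hV, hU⟩ := drc W B (fun l => B.filter (fun b => l * b ∈ B))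
    (fun w _ => Finset.filter_subset _ _) L hL hB hW (fun w hw => (mem_MS.1 (hWL hw)).2)
  refine ⟨V, hVW, hV, ?_⟩
  set Z := MS (32 * L ^ 2) B with hZ
  have hne : ∀ w ∈ W, w ≠ 0 := fun w hw => (mem_MS.1 (hWL hw)).1
  have key : ∀ x ∈ W, ∀ w ∈ W, (B.card : ℝ) ≤ 32 * L ^ 2 *
      ((B.filter (fun b => x * b ∈ B)) ∩ (B.filter (fun b => w * b ∈ B))).card →
      x / w ∈ Z ∧ w / x ∈ Z := by
    have key1 : ∀ x ∈ W, ∀ w ∈ W, (B.card : ℝ) ≤ 32 * L ^ 2 *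
      ((B.filter (fun b => x * b ∈ B)) ∩ (B.filter (fun b => w * b ∈ B))).card → x / w ∈ Z := by
      intro x hx w hw h
      rw [hZ, mem_MS]
      refine ⟨div_ne_zero (hne x hx) (hne w hw), h.trans ?_⟩
      gcongr
      apply Finset.card_le_card_of_injOn (fun b => w * b)
      · intro b hb
        simp at hb ⊢
        refine ⟨hb.2.2, ?_⟩
        have : x / w * (w * b) = x * b := by
          field_simp [hne w hw]
        rw [this]; exact hb.1.2
      · intro a _ b _ h
        exact mul_left_cancel₀ (hne w hw) h
    intro x hx w hw h
    refine ⟨key1 x hx w hw h, key1 w hw x hx ?_⟩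
    rwa [Finset.inter_comm]
  -- representation counting
  have hrep : ∀ d ∈ V / V, (W.card : ℝ) ≤
      4 * L * (((Z ×ˢ Z).filter (fun q => q.1 * q.2 = d)).card : ℝ) := by
    intro d hd
    obtain ⟨a, ha, c, hc, rfl⟩ := Finset.mem_div.1 hd
    obtain ⟨U, hUW, hUc, hUp⟩ := hU a ha c hc
    refine hUc.trans ?_
    gcongr
    apply Finset.card_le_card_of_injOn (fun w => (a / w, w / c))
    · intro w hw
      have e := hUp w hw
      simp only [coe_filter, mem_product, Set.mem_ofPred_eq]
      refine ⟨⟨(key a (hVW ha) w (hUW hw) e.1).1, (key c (hVW hc) w (hUW hw) e.2).2⟩, ?_⟩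
      have := hne w (hUW hw)
      field_simp
    · intro w hw w' hw' h
      simp only [Prod.mk.injEq] at h
      have := hne c (hVW hc)
      exact (div_left_inj' this).1 h.2
  have h1 : ((V / V).card : ℝ) * W.card ≤
      4 * L * ∑ d ∈ V / V, (((Z ×ˢ Z).filter (fun q => q.1 * q.2 = d)).card : ℝ) := by
    rw [Finset.mul_sum]
    calc ((V / V).card : ℝ) * W.card = ∑ d ∈ V / V, (W.card : ℝ) := by simp
      _ ≤ _ := Finset.sum_le_sum hrep
  refine h1.trans ?_
  gcongr
  have h2 : ∑ d ∈ V / V, ((Z ×ˢ Z).filter (fun q => q.1 * q.2 = d)).card ≤ (Z ×ˢ Z).card := by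
    rw [Finset.sum_card_fiberwise_eq_card_filter]
    exact Finset.card_filter_le _ _
  rw [Finset.card_product, ← sq] at h2
  exact_mod_cast h2

lemma bsg_add {p : ℕ} [Fact p.Prime] {L : ℝ} (hL : 1 ≤ L) (B : Finset (ZMod p))
    (hB : B.Nonempty) (W : Finset (ZMod p)) (hWL : W ⊆ AS L B) (hW : W.Nonempty) :
    ∃ V ⊆ W, (W.card : ℝ) ≤ 4 * L * V.card ∧
      ((V - V).card : ℝ) * W.card ≤ 4 * L * ((AS (32 * L ^ 2) B).card : ℝ) ^ 2 := by
  classical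
  obtain ⟨V, hVW, hV, hU⟩ := drc W B (fun l => B.filter (fun b => b + l ∈ B))
    (fun w _ => Finset.filter_subset _ _) L hL hB hW (fun w hw => (mem_AS.1 (hWL hw)))
  refine ⟨V, hVW, hV, ?_⟩
  set Z := AS (32 * L ^ 2) B with hZ
  have key : ∀ x ∈ W, ∀ w ∈ W, (B.card : ℝ) ≤ 32 * L ^ 2 *
      ((B.filter (fun b => b + x ∈ B)) ∩ (B.filter (fun b => b + w ∈ B))).card →
      x - w ∈ Z ∧ w - x ∈ Z := by
    have key1 : ∀ x ∈ W, ∀ w ∈ W, (B.card : ℝ) ≤ 32 * L ^ 2 *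
      ((B.filter (fun b => b + x ∈ B)) ∩ (B.filter (fun b => b + w ∈ B))).card → x - w ∈ Z := by
      intro x hx w hw h
      rw [hZ, mem_AS]
      refine h.trans ?_
      gcongr
      apply Finset.card_le_card_of_injOn (fun b => b + w)
      · intro b hb
        simp at hb ⊢
        refine ⟨hb.2.2, ?_⟩
        have : b + w + (x - w) = b + x := by ring
        exact hb.1.2
      · intro a _ b _ h
        exact add_right_cancel h
    intro x hx w hw h
    refine ⟨key1 x hx w hw h, key1 w hw x hx ?_⟩
    rwa [Finset.inter_comm]
  have hrep : ∀ d ∈ V - V, (W.card : ℝ) ≤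
      4 * L * (((Z ×ˢ Z).filter (fun q => q.1 + q.2 = d)).card : ℝ) := by
    intro d hd
    obtain ⟨a, ha, c, hc, rfl⟩ := Finset.mem_sub.1 hd
    obtain ⟨U, hUW, hUc, hUp⟩ := hU a ha c hc
    refine hUc.trans ?_
    gcongr
    apply Finset.card_le_card_of_injOn (fun w => (a - w, w - c))
    · intro w hw
      have e := hUp w hw
      simp only [coe_filter, mem_product, Set.mem_ofPred_eq]
      refine ⟨⟨(key a (hVW ha) w (hUW hw) e.1).1, (key c (hVW hc) w (hUW hw) e.2).2⟩, ?_⟩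
      ring
    · intro w hw w' hw' h
      simp only [Prod.mk.injEq] at h
      exact sub_left_injective h.2
  have h1 : ((V - V).card : ℝ) * W.card ≤
      4 * L * ∑ d ∈ V - V, (((Z ×ˢ Z).filter (fun q => q.1 + q.2 = d)).card : ℝ) := by
    rw [Finset.mul_sum]
    calc ((V - V).card : ℝ) * W.card = ∑ d ∈ V - V, (W.card : ℝ) := by simp
      _ ≤ _ := Finset.sum_le_sum hrep
  refine h1.trans ?_
  gcongr
  have h2 : ∑ d ∈ V - V, ((Z ×ˢ Z).filter (fun q => q.1 + q.2 = d)).card ≤ (Z ×ˢ Z).card := by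
    rw [Finset.sum_card_fiberwise_eq_card_filter]
    exact Finset.card_filter_le _ _
  rw [Finset.card_product, ← sq] at h2
  exact_mod_cast h2

end SP

namespace SP
open Finset
open scoped Pointwise

lemma sum_weight {α : Type*} [DecidableEq α] (V U : Finset α) (hU : U ⊆ V) (q : ℝ) :
    ∑ S ∈ V.powerset.filter (fun S => U ⊆ S), q ^ #S * (1 - q) ^ (#V - #S) = q ^ #U := by
  have h := Finset.sum_pow_mul_eq_add_pow q (1 - q) (V \ U)
  have h2 : ∑ S ∈ V.powerset.filter (fun S => U ⊆ S), q ^ #S * (1 - q) ^ (#V - #S) =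
      ∑ T ∈ (V \ U).powerset, q ^ #U * (q ^ #T * (1 - q) ^ (#(V \ U) - #T)) := by
    symm
    apply Finset.sum_bij' (fun T _ => U ∪ T) (fun S _ => S \ U)
    · intro T hT
      simp only [mem_powerset] at hT
      simp only [mem_filter, mem_powerset]
      exact ⟨union_subset hU (hT.trans sdiff_subset), subset_union_left⟩
    · intro S hS
      simp only [mem_filter, mem_powerset] at hS ⊢
      exact sdiff_subset_sdiff hS.1 le_rfl
    · intro T hT
      simp only [mem_powerset] at hT
      ext x
      simp only [mem_sdiff, mem_union]
      constructor
      · tauto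
      · intro hx
        exact ⟨Or.inr hx, (mem_sdiff.1 (hT hx)).2⟩
    · intro S hS
      simp only [mem_filter, mem_powerset] at hS
      exact union_sdiff_of_subset hS.2
    · intro T hT
      simp only [mem_powerset] at hT
      have hd : Disjoint U T := by
        rw [Finset.disjoint_left]
        intro x hx hxT
        exact (mem_sdiff.1 (hT hxT)).2 hx
      rw [card_union_of_disjoint hd, card_sdiff_of_subset hU, pow_add, Nat.sub_sub, mul_assoc]
  rw [h2, ← Finset.mul_sum, h]
  simp

/-- random subset lemma -/
lemma random_subset {α ι : Type*} [DecidableEq α] (V : Finset α) (I : Finset ι)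
    (U : ι → Finset α) (s : ℕ) (hU : ∀ i ∈ I, U i ⊆ V) (hs : ∀ i ∈ I, #(U i) = s) (q : ℝ)
    (h0 : 0 ≤ q) (h1 : q ≤ 1) :
    ∃ S ⊆ V, q * #V - q ^ s * #I ≤ (#S : ℝ) - #(I.filter (fun i => U i ⊆ S)) := by
  set w : Finset α → ℝ := fun S => q ^ #S * (1 - q) ^ (#V - #S) with hw
  have hw0 : ∀ S, 0 ≤ w S := fun S => by
    have : 0 ≤ 1 - q := by linarith
    positivity
  have hw1 : ∑ S ∈ V.powerset, w S = 1 := by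
    have := sum_weight V ∅ (by simp) q
    simpa using this
  have hcard : ∑ S ∈ V.powerset, w S * #S = q * #V := by
    have e : ∀ S ∈ V.powerset, w S * (#S : ℝ) = ∑ v ∈ V, if v ∈ S then w S else 0 := by
      intro S hS
      rw [mem_powerset] at hS
      rw [← Finset.sum_filter, Finset.filter_mem_eq_inter, inter_eq_right.2 hS]
      simp [mul_comm]
    rw [Finset.sum_congr rfl e, Finset.sum_comm]
    have e2 : ∀ v ∈ V, ∑ S ∈ V.powerset, (if v ∈ S then w S else 0) = q := by
      intro v hv
      have := sum_weight V {v} (by simpa using hv) q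
      rw [← Finset.sum_filter]
      simpa using this
    rw [Finset.sum_congr rfl e2]
    simp [mul_comm]
  have hbad : ∑ S ∈ V.powerset, w S * #(I.filter (fun i => U i ⊆ S)) = q ^ s * #I := by
    have e : ∀ S ∈ V.powerset, w S * (#(I.filter (fun i => U i ⊆ S)) : ℝ) =
        ∑ i ∈ I, if U i ⊆ S then w S else 0 := by
      intro S hS
      rw [← Finset.sum_filter]
      simp [mul_comm]
    rw [Finset.sum_congr rfl e, Finset.sum_comm]
    have e2 : ∀ i ∈ I, ∑ S ∈ V.powerset, (if U i ⊆ S then w S else 0) = q ^ s := by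
      intro i hi
      have := sum_weight V (U i) (hU i hi) q
      rw [← Finset.sum_filter, this, hs i hi]
    rw [Finset.sum_congr rfl e2]
    simp [mul_comm]
  by_contra hc
  push Not at hc
  obtain ⟨S0, hS0, hS0w⟩ : ∃ S ∈ V.powerset, 0 < w S := by
    by_contra hn
    push Not at hn
    have := Finset.sum_nonpos hn
    linarith
  have : ∑ S ∈ V.powerset, w S * ((#S : ℝ) - #(I.filter (fun i => U i ⊆ S))) <
      ∑ S ∈ V.powerset, w S * (q * #V - q ^ s * #I) := by
    apply Finset.sum_lt_sum
    · intro S hS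
      exact mul_le_mul_of_nonneg_left (hc S (mem_powerset.1 hS)).le (hw0 S)
    · exact ⟨S0, hS0, mul_lt_mul_of_pos_left (hc S0 (mem_powerset.1 hS0)) hS0w⟩
  rw [← Finset.sum_mul, hw1] at this
  simp_rw [mul_sub] at this
  rw [Finset.sum_sub_distrib, hcard, hbad] at this
  linarith

/-- deletion corollary -/
lemma random_subset_del {α ι : Type*} [DecidableEq α] [Nonempty α] (V : Finset α) (I : Finset ι)
    (U : ι → Finset α) (s : ℕ) (hs1 : 1 ≤ s) (hU : ∀ i ∈ I, U i ⊆ V) (hs : ∀ i ∈ I, #(U i) = s)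
    (q : ℝ) (h0 : 0 ≤ q) (h1 : q ≤ 1) :
    ∃ S ⊆ V, q * #V - q ^ s * #I ≤ (#S : ℝ) ∧ ∀ i ∈ I, ¬ (U i ⊆ S) := by
  classical
  obtain ⟨S, hSV, hS⟩ := random_subset V I U s hU hs q h0 h1
  have hne : ∀ i, i ∈ I → ∃ x, x ∈ U i := by
    intro i hi
    have : 0 < #(U i) := by rw [hs i hi]; omega
    exact card_pos.1 this
  choose! f hf using hne
  refine ⟨S \ (I.filter (fun i => U i ⊆ S)).image f, sdiff_subset.trans hSV, ?_, ?_⟩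
  · have a1 := Finset.le_card_sdiff ((I.filter (fun i => U i ⊆ S)).image f) S
    have a2 := Finset.card_image_le (s := I.filter (fun i => U i ⊆ S)) (f := f)
    have a3 : (#S : ℝ) ≤ #(S \ (I.filter (fun i => U i ⊆ S)).image f) +
        #(I.filter (fun i => U i ⊆ S)) := by
      exact_mod_cast (by omega)
    linarith
  · intro i hi hsub
    have h2 := hsub (hf i hi)
    rw [mem_sdiff, mem_image] at h2
    exact h2.2 ⟨i, mem_filter.2 ⟨hi, hsub.trans sdiff_subset⟩, rfl⟩

end SP

namespace SP
open Finset
open scoped Pointwise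

lemma mulPairCount_le {p : ℕ} [Fact p.Prime] (S : Finset (ZMod p)) (l : ZMod p) :
    mulPairCount l S ≤ mr S l := by
  unfold mulPairCount mr
  have : {q : ZMod p × ZMod p | q.1 ∈ S ∧ q.2 ∈ S ∧ q.1 = l * q.2} ⊆
      (((S.filter (fun b => l * b ∈ S)).image (fun y => (l * y, y)) : Finset (ZMod p × ZMod p)) :
        Set (ZMod p × ZMod p)) := by
    rintro ⟨a, b⟩ ⟨h1, h2, h3⟩
    simp only at h1 h2 h3
    simp only [coe_image, Set.mem_image, mem_coe, mem_filter]
    exact ⟨b, ⟨h2, h3 ▸ h1⟩, by rw [h3]⟩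
  refine (Set.ncard_le_ncard this (Finset.finite_toSet _)).trans ?_
  rw [Set.ncard_coe_finset]
  exact Finset.card_image_le

lemma disjoint_sub {p : ℕ} [Fact p.Prime] (l : ZMod p) (hl0 : l ≠ 0) (hl1 : l ≠ 1)
    (Y : Finset (ZMod p)) (h0 : (0 : ZMod p) ∉ Y) (k : ℕ) (hk : 3 * k < #Y + 3) :
    ∃ I ⊆ Y, #I = k ∧ Disjoint I (I.image (fun y => l * y)) := by
  induction k with
  | zero => exact ⟨∅, by simp⟩
  | succ j ih =>
    obtain ⟨I, hI, hc, hd⟩ := ih (by omega)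
    have h1 : #(I ∪ I.image (fun y => l * y) ∪ I.image (fun y => l⁻¹ * y)) < #Y := by
      have a1 := card_union_le (I ∪ I.image (fun y => l * y)) (I.image (fun y => l⁻¹ * y))
      have a2 := card_union_le I (I.image (fun y => l * y))
      have a3 := card_image_le (s := I) (f := fun y => l * y)
      have a4 := card_image_le (s := I) (f := fun y => l⁻¹ * y)
      omega
    obtain ⟨y, hyY, hy⟩ := exists_mem_notMem_of_card_lt_card h1
    simp only [mem_union, not_or] at hy
    obtain ⟨⟨hy1, hy2⟩, hy3⟩ := hy
    have hy0 : y ≠ 0 := fun h => h0 (h ▸ hyY)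
    refine ⟨insert y I, insert_subset hyY hI, by rw [card_insert_of_notMem hy1, hc], ?_⟩
    rw [image_insert, disjoint_insert_left, disjoint_insert_right]
    refine ⟨?_, ?_, hd⟩
    · rw [mem_insert, not_or]
      refine ⟨?_, hy2⟩
      intro h
      apply hl1
      have : l * y = 1 * y := by rw [one_mul]; exact h.symm
      exact mul_right_cancel₀ hy0 this
    · intro h
      apply hy3
      rw [mem_image]
      exact ⟨l * y, h, by field_simp⟩

open Classical in
lemma sidon_subset {p : ℕ} [Fact p.Prime] (k : ℕ) (hk : 4 ≤ k) (x : ℝ) (hx : 1 ≤ x)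
    (B : Finset (ZMod p)) (h0 : (0 : ZMod p) ∉ B) (hB1 : (#B : ℝ) ≤ x ^ (16 * k))
    (hB2 : x ^ (16 * k) ≤ x ^ 2 * #B)
    (hR : (#((univ : Finset (ZMod p)).filter
      (fun l => l ≠ 0 ∧ l ≠ 1 ∧ (#B : ℝ) ≤ x ^ 16 * mr B l)) : ℝ) < x ^ (4 * k)) :
    ∃ S ⊆ B, IsMulSidon (3 * k : ℝ) S ∧ x ^ (8 * k + 1) / 8 ≤ #S := by
  set R := (univ : Finset (ZMod p)).filter
      (fun l => l ≠ 0 ∧ l ≠ 1 ∧ (#B : ℝ) ≤ x ^ 16 * mr B l) with hRdef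
  set T := (univ : Finset (ZMod p)).filter (fun l => l ≠ 0 ∧ l ≠ 1) with hT
  have hx0 : 0 < x := by linarith
  set m : ℝ := ((#B : ℕ) : ℝ) with hm
  have hmpos : 0 < m := by
    by_contra hc
    push Not at hc
    have : 0 < x ^ (16 * k) := by positivity
    nlinarith [sq_nonneg x]
  have hmr : ∀ l, (mr B l : ℝ) ≤ m := fun l => by
    simp only [hm, mr]
    exact_mod_cast card_filter_le _ _
  -- the bound on the sum of powers
  have hsum : ∑ l ∈ T, (mr B l : ℝ) ^ k ≤ 2 * x ^ (4 * k) * m ^ k := by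
    have hsplit : ∑ l ∈ T, (mr B l : ℝ) ^ k ≤
        ∑ l ∈ R, (mr B l : ℝ) ^ k +
          ∑ l ∈ T.filter (fun l => x ^ 16 * (mr B l : ℝ) < m), (mr B l : ℝ) ^ k := by
      have hTs : T ⊆ R ∪ T.filter (fun l => x ^ 16 * (mr B l : ℝ) < m) := by
        intro l hl
        rw [mem_union, hRdef, mem_filter, mem_filter]
        rw [hT, mem_filter] at hl
        rcases le_or_gt m (x ^ 16 * (mr B l : ℝ)) with h | h
        · exact Or.inl ⟨mem_univ _, hl.2.1, hl.2.2, h⟩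
        · refine Or.inr ⟨?_, h⟩
          rw [hT, mem_filter]; exact hl
      calc _ ≤ ∑ l ∈ R ∪ T.filter (fun l => x ^ 16 * (mr B l : ℝ) < m), (mr B l : ℝ) ^ k :=
            sum_le_sum_of_subset_of_nonneg hTs (fun _ _ _ => by positivity)
        _ ≤ _ := by
          rw [← Finset.sum_union_inter]
          have : 0 ≤ ∑ l ∈ R ∩ T.filter (fun l => x ^ 16 * (mr B l : ℝ) < m),
              (mr B l : ℝ) ^ k := by positivity
          linarith
    have hp1 : ∑ l ∈ R, (mr B l : ℝ) ^ k ≤ x ^ (4 * k) * m ^ k := by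
      calc _ ≤ ∑ l ∈ R, m ^ k := by
            refine sum_le_sum fun l _ => ?_
            exact pow_le_pow_left₀ (by positivity) (hmr l) k
        _ = #R * m ^ k := by simp
        _ ≤ _ := by
          gcongr
    have hp2 : ∑ l ∈ T.filter (fun l => x ^ 16 * (mr B l : ℝ) < m), (mr B l : ℝ) ^ k ≤
        x ^ (4 * k) * m ^ k := by
      obtain ⟨j, rfl⟩ : ∃ j, k = j + 1 := ⟨k - 1, by omega⟩
      have e1 : ∀ l ∈ T.filter (fun l => x ^ 16 * (mr B l : ℝ) < m),
          x ^ (16 * j) * (mr B l : ℝ) ^ (j + 1) ≤ m ^ j * (mr B l : ℝ) := by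
        intro l hl
        rw [mem_filter] at hl
        calc x ^ (16 * j) * (mr B l : ℝ) ^ (j + 1) = (x ^ 16 * (mr B l : ℝ)) ^ j * (mr B l : ℝ) := by
              rw [mul_pow, pow_mul]; ring
          _ ≤ _ := by
              gcongr
              exact hl.2.le
      have e2 : x ^ (16 * j) * ∑ l ∈ T.filter (fun l => x ^ 16 * (mr B l : ℝ) < m),
          (mr B l : ℝ) ^ (j + 1) ≤ m ^ j * m ^ 2 := by
        rw [mul_sum]
        refine (sum_le_sum e1).trans ?_
        rw [← mul_sum]
        gcongr
        have := sum_mr_le B h0 (T.filter (fun l => x ^ 16 * (mr B l : ℝ) < m))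
        rw [hm]
        exact_mod_cast this
      have e3 : m ^ j * m ^ 2 ≤ x ^ (16 * j) * (x ^ (4 * (j + 1)) * m ^ (j + 1)) := by
        calc m ^ j * m ^ 2 = m ^ (j + 1) * m := by ring
          _ ≤ m ^ (j + 1) * x ^ (16 * (j + 1)) := by gcongr
          _ = m ^ (j + 1) * (x ^ (16 * j) * x ^ 16) := by rw [← pow_add]; ring_nf
          _ ≤ m ^ (j + 1) * (x ^ (16 * j) * x ^ (4 * (j + 1))) := by
              gcongr
              omega
          _ = _ := by ring
      exact le_of_mul_le_mul_left (e2.trans e3) (by positivity)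
    linarith
  -- bad configurations
  set Y : ZMod p → Finset (ZMod p) := fun l => B.filter (fun b => l * b ∈ B) with hY
  set J : Finset ((_ : ZMod p) × Finset (ZMod p)) :=
    T.sigma (fun l => (powersetCard k (Y l)).filter
      (fun I => Disjoint I (I.image (fun y => l * y)))) with hJ
  set U : ((_ : ZMod p) × Finset (ZMod p)) → Finset (ZMod p) :=
    fun i => i.2 ∪ i.2.image (fun y => i.1 * y) with hU
  have hJcard : (#J : ℝ) ≤ 2 * x ^ (4 * k) * m ^ k := by
    refine le_trans ?_ hsum
    rw [hJ, card_sigma]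
    push_cast
    refine sum_le_sum fun l _ => ?_
    have a1 : #((powersetCard k (Y l)).filter (fun I => Disjoint I (I.image (fun y => l * y))))
        ≤ (mr B l) ^ k := by
      refine (card_filter_le _ _).trans ?_
      rw [card_powersetCard]
      exact Nat.choose_le_pow _ _
    exact_mod_cast a1
  have hUB : ∀ i ∈ J, U i ⊆ B := by
    rintro ⟨l, I⟩ hi
    simp only [hJ, mem_sigma, mem_filter, mem_powersetCard] at hi
    simp only [hU]
    apply union_subset
    · exact hi.2.1.1.trans (filter_subset _ _)
    · intro z hz
      obtain ⟨y, hy, rfl⟩ := mem_image.1 hz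
      exact (mem_filter.1 (hi.2.1.1 hy)).2
  have hUc : ∀ i ∈ J, #(U i) = 2 * k := by
    rintro ⟨l, I⟩ hi
    simp only [hJ, mem_sigma, mem_filter, mem_powersetCard, hT] at hi
    simp only [hU]
    rw [card_union_of_disjoint hi.2.2, card_image_of_injective, hi.2.1.2]
    · ring
    · exact mul_right_injective₀ hi.1.2.1
  set q : ℝ := x ^ (8 * k + 1) / (4 * m) with hq
  have hq0 : 0 ≤ q := by positivity
  have hq1 : q ≤ 1 := by
    rw [hq, div_le_one (by positivity)]
    have : x ^ 2 * x ^ (8 * k + 1) ≤ x ^ 2 * (4 * m) := by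
      calc x ^ 2 * x ^ (8 * k + 1) = x ^ (8 * k + 3) := by rw [← pow_add]; ring_nf
        _ ≤ x ^ (16 * k) := pow_le_pow_right₀ hx (by omega)
        _ ≤ x ^ 2 * m := hB2
        _ ≤ _ := by nlinarith [sq_nonneg x]
    exact le_of_mul_le_mul_left this (by positivity)
  obtain ⟨S, hSB, hSc, hSbad⟩ := random_subset_del B J U (2 * k) (by omega) hUB hUc q hq0 hq1
  refine ⟨S, hSB, ?_, ?_⟩
  · intro l hl
    have h1 := mulPairCount_le S l
    have h2 : mr S l ≤ 3 * k := by
      by_contra hc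
      push Not at hc
      by_cases hl0 : l = 0
      · have : mr S l = 0 := by
          rw [mr, card_eq_zero, filter_eq_empty_iff, hl0]
          intro y hy
          rw [zero_mul]
          exact fun h => h0 (hSB h)
        omega
      obtain ⟨I, hI, hIc, hId⟩ := disjoint_sub l hl0 hl (S.filter (fun b => l * b ∈ S))
        (fun h => h0 (hSB (mem_filter.1 h).1)) k (by unfold mr at hc; omega)
      refine hSbad ⟨l, I⟩ ?_ ?_
      · simp only [hJ, mem_sigma, mem_filter, mem_powersetCard, hT]
        refine ⟨⟨mem_univ _, hl0, hl⟩, ⟨?_, hIc⟩, hId⟩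
        intro y hy
        have := mem_filter.1 (hI hy)
        exact mem_filter.2 ⟨hSB this.1, hSB this.2⟩
      · simp only [hU]
        apply union_subset
        · exact hI.trans (filter_subset _ _)
        · intro z hz
          obtain ⟨y, hy, rfl⟩ := mem_image.1 hz
          exact (mem_filter.1 (hI hy)).2
    exact_mod_cast h1.trans h2
  · refine le_trans ?_ hSc
    have e1 : q * m = x ^ (8 * k + 1) / 4 := by
      rw [hq]; field_simp
    have e2 : q ^ (2 * k) * #J ≤ x ^ (8 * k + 1) / 8 := by
      have f1 : (x ^ (16 * k)) ^ k ≤ (x ^ 2 * m) ^ k := pow_le_pow_left₀ (by positivity) hB2 k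
      have f2 : q ^ (2 * k) * (2 * x ^ (4 * k) * m ^ k) =
          2 * x ^ (4 * k) * (x ^ (8 * k + 1)) ^ (2 * k) / (4 ^ (2 * k) * m ^ k) := by
        rw [hq, div_pow, mul_pow]
        have : m ^ (2 * k) = m ^ k * m ^ k := by rw [two_mul, pow_add]
        rw [this]
        field_simp
      calc q ^ (2 * k) * #J ≤ q ^ (2 * k) * (2 * x ^ (4 * k) * m ^ k) := by gcongr
        _ = _ := f2
        _ ≤ _ := by
          rw [div_le_iff₀ (by positivity)]
          have g1 : (16 : ℝ) ≤ 4 ^ (2 * k) := by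
            calc (16 : ℝ) = 4 ^ 2 := by norm_num
              _ ≤ 4 ^ (2 * k) := pow_le_pow_right₀ (by norm_num) (by omega)
          have g2 : x ^ (4 * k) * (x ^ (8 * k + 1)) ^ (2 * k) ≤ x ^ (8 * k + 1) * m ^ k := by
            have g3 : x ^ (4 * k) * (x ^ (8 * k + 1)) ^ (2 * k) = x ^ (6 * k) * (x ^ (16 * k)) ^ k := by
              rw [← pow_mul, ← pow_mul, ← pow_add, ← pow_add]
              congr 1; ring
            rw [g3]
            calc x ^ (6 * k) * (x ^ (16 * k)) ^ k ≤ x ^ (6 * k) * (x ^ 2 * m) ^ k := by gcongr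
              _ = x ^ (8 * k) * m ^ k := by
                rw [mul_pow, ← pow_mul, ← mul_assoc, ← pow_add]; congr 2; ring
              _ ≤ _ := by
                gcongr
                omega
          have g4 : 0 ≤ x ^ (8 * k + 1) * m ^ k := by positivity
          nlinarith
    linarith

end SP

namespace SP
open Finset
open scoped Pointwise

open Classical in
lemma popular {ι : Type*} (I : Finset ι) (f : ι → ℝ) (M s : ℝ)
    (hs0 : 0 ≤ s) (hf : ∀ i ∈ I, f i ≤ M) (hs : s * #I ≤ ∑ i ∈ I, f i) :
    s * #I ≤ 2 * M * #(I.filter (fun i => s ≤ 2 * f i)) := by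
  have h1 : ∑ i ∈ I, f i ≤ M * #(I.filter (fun i => s ≤ 2 * f i)) + s / 2 * #I := by
    rw [← sum_filter_add_sum_filter_not I (fun i => s ≤ 2 * f i)]
    have a1 : ∑ i ∈ I.filter (fun i => s ≤ 2 * f i), f i ≤
        ∑ i ∈ I.filter (fun i => s ≤ 2 * f i), M :=
      sum_le_sum fun i hi => hf i (mem_filter.1 hi).1
    have a2 : ∑ i ∈ I.filter (fun i => ¬ s ≤ 2 * f i), f i ≤
        ∑ i ∈ I.filter (fun i => ¬ s ≤ 2 * f i), s / 2 :=
      sum_le_sum fun i hi => by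
        have := (mem_filter.1 hi).2
        linarith
    have a3 : (#(I.filter (fun i => ¬ s ≤ 2 * f i)) : ℝ) ≤ #I := by
      exact_mod_cast card_filter_le _ _
    simp only [sum_const, nsmul_eq_mul] at a1 a2
    nlinarith
  linarith

/-- double counting -/
lemma dc {α β : Type*} (I : Finset α) (J : Finset β) (r : α → β → Prop)
    [∀ a b, Decidable (r a b)] :
    ∑ a ∈ I, (#(J.filter (fun b => r a b)) : ℝ) = ∑ b ∈ J, (#(I.filter (fun a => r a b)) : ℝ) := by
  exact_mod_cast sum_card_bipartiteAbove_eq_sum_card_bipartiteBelow r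

open Classical in
lemma trans_rich {p : ℕ} [Fact p.Prime] (B : Finset (ZMod p)) (hB : B.Nonempty)
    (h0 : (0 : ZMod p) ∉ B) (L : ℝ) (hL : 1 ≤ L) (κ L2 : ℝ) (hκ0 : 0 < κ) (hL2 : 0 < L2)
    (hP : (MS L B).Nonempty)
    (hκ : (#(MS (32 * L ^ 2) B) : ℝ) ≤ κ * #(MS L B))
    (hyp : ∀ B1 ⊆ B, (#B : ℝ) ≤ 2 * L * #B1 → ∃ μ : ZMod p, μ ≠ 1 ∧ μ ≠ 0 ∧
      (#B1 : ℝ) ≤ L2 * #(B1.filter (fun b => μ * (b + 1) - 1 ∈ B1)))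
    (Λ : ℝ) (hΛ : Λ = 128 * L ^ 5 * L2 * κ ^ 2) :
    (#(MS L B) : ℝ) ≤ 8 * L * Λ ^ 2 * #(AS (2 * Λ ^ 2) B) := by
  have hLpos : 0 < L := by linarith
  obtain ⟨V, hVP, hV, hVV⟩ := bsg_mul hL B hB (MS L B) le_rfl hP
  set P := MS L B with hPdef
  have hPpos : (0 : ℝ) < #P := by exact_mod_cast hP.card_pos
  have hBpos : (0 : ℝ) < #B := by exact_mod_cast hB.card_pos
  have hVpos : (0 : ℝ) < #V := by
    by_contra hc
    push Not at hc
    nlinarith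
  have hVne : V.Nonempty := card_pos.1 (by exact_mod_cast hVpos)
  have hne : ∀ l ∈ V, l ≠ 0 := fun l hl => (mem_MS.1 (hVP hl)).1
  have hVV2 : (#(V / V) : ℝ) ≤ 16 * L ^ 2 * κ ^ 2 * #V := by
    have a1 : (#(V / V) : ℝ) * #P ≤ 4 * L * (κ * #P) ^ 2 := by
      refine hVV.trans ?_
      gcongr
    have a2 : (#(V / V) : ℝ) ≤ 4 * L * κ ^ 2 * #P := by
      refine le_of_mul_le_mul_right ?_ hPpos
      linarith
    refine a2.trans ?_
    have : 0 ≤ 4 * L * κ ^ 2 := by positivity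
    nlinarith
  -- B1
  set B1 := B.filter (fun b => (#V : ℝ) / L ≤ 2 * #(V.filter (fun l => l * b ∈ B))) with hB1
  have hB1c : (#B : ℝ) ≤ 2 * L * #B1 := by
    have := popular B (fun b => (#(V.filter (fun l => l * b ∈ B)) : ℝ)) #V (#V / L)
      (by positivity) (fun b _ => by exact_mod_cast card_filter_le _ _) (by
        rw [dc B V (fun b l => l * b ∈ B)]
        have : ∀ l ∈ V, (#B : ℝ) / L ≤ #(B.filter (fun b => l * b ∈ B)) := by
          intro l hl
          rw [div_le_iff₀ hLpos]
          have := (mem_MS.1 (hVP hl)).2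
          unfold mr at this
          linarith
        calc (#V : ℝ) / L * #B = ∑ l ∈ V, (#B : ℝ) / L := by simp; ring
          _ ≤ _ := sum_le_sum this)
    have h3 : (#V : ℝ) * #B ≤ #V * (2 * L * #B1) := by
      have e : (#V : ℝ) / L * #B = (#V * #B) / L := by ring
      rw [e, div_le_iff₀ hLpos] at this
      linarith
    exact le_of_mul_le_mul_left h3 hVpos
  obtain ⟨μ, hμ1, hμ0, hμ⟩ := hyp B1 (filter_subset _ _) hB1c
  set B2 := B1.filter (fun b => μ * (b + 1) - 1 ∈ B1) with hB2
  set N : ZMod p → Finset (ZMod p × ZMod p) := fun h => (B ×ˢ V).filter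
    (fun q => h * μ * q.1 + q.2 * (μ - 1) ∈ B) with hN
  -- counting T
  set T : Finset ((_ : ZMod p) × (ZMod p × ZMod p)) := B2.sigma (fun b =>
    (V.filter (fun l => l * b ∈ B)) ×ˢ (V.filter (fun l => l * (μ * (b + 1) - 1) ∈ B))) with hT
  have hTc : (#B : ℝ) * #V ^ 2 ≤ 8 * L ^ 3 * L2 * #T := by
    have a1 : ∀ b ∈ B2, (#V / (2 * L) : ℝ) ^ 2 ≤ (#((V.filter (fun l => l * b ∈ B)) ×ˢ
        (V.filter (fun l => l * (μ * (b + 1) - 1) ∈ B))) : ℝ) := by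
      intro b hb
      rw [hB2, mem_filter] at hb
      have b1 := (mem_filter.1 hb.1).2
      have b2 := (mem_filter.1 hb.2).2
      rw [card_product, sq]
      push_cast
      have e : (#V : ℝ) / L = 2 * (#V / (2 * L)) := by field_simp
      apply mul_le_mul
      · linarith
      · linarith
      · positivity
      · positivity
    have a2 : (#B2 : ℝ) * (#V / (2 * L) : ℝ) ^ 2 ≤ #T := by
      rw [hT, card_sigma]
      push_cast
      calc (#B2 : ℝ) * (#V / (2 * L) : ℝ) ^ 2 = ∑ b ∈ B2, (#V / (2 * L) : ℝ) ^ 2 := by simp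
        _ ≤ _ := by
          refine sum_le_sum fun b hb => ?_
          exact a1 b hb
    have a3 : (#B2 : ℝ) * (#V : ℝ) ^ 2 ≤ 4 * L ^ 2 * #T := by
      have : (#B2 : ℝ) * (#V / (2 * L) : ℝ) ^ 2 = (#B2 : ℝ) * (#V : ℝ) ^ 2 / (4 * L ^ 2) := by
        field_simp; norm_num
      rw [this, div_le_iff₀ (by positivity)] at a2
      linarith
    calc (#B : ℝ) * #V ^ 2 ≤ (2 * L * (L2 * #B2)) * #V ^ 2 := by
          gcongr
          refine hB1c.trans ?_
          gcongr
      _ = 2 * L * L2 * (#B2 * #V ^ 2) := by ring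
      _ ≤ 2 * L * L2 * (4 * L ^ 2 * #T) := by gcongr
      _ = _ := by ring
  have hTN : (#T : ℝ) ≤ ∑ h ∈ V / V, (#(N h) : ℝ) := by
    have : #T ≤ #((V / V).sigma N) := by
      apply card_le_card_of_injOn (fun q => ⟨q.2.2 / q.2.1, (q.2.1 * q.1, q.2.2)⟩)
      · rintro ⟨b, l, l'⟩ hq
        simp only [hT, mem_coe, mem_sigma, mem_product, mem_filter] at hq
        obtain ⟨hb, ⟨hl, hlb⟩, hl', hlb'⟩ := hq
        simp only [hN, mem_coe, mem_sigma, mem_product, mem_filter]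
        refine ⟨div_mem_div hl' hl, ⟨hlb, hl'⟩, ?_⟩
        have := hne l hl
        have e : l' / l * μ * (l * b) + l' * (μ - 1) = l' * (μ * (b + 1) - 1) := by
          field_simp; ring
        rw [e]; exact hlb'
      · rintro ⟨b, l, l'⟩ hq ⟨c, m, m'⟩ hr h
        simp only [hT, mem_coe, mem_sigma, mem_product, mem_filter] at hq hr
        simp only [Sigma.mk.injEq, Prod.mk.injEq, heq_eq_eq] at h
        obtain ⟨h1, h2, h3⟩ := h
        subst h3
        have n1 := hne l hq.2.1.1
        have n2 := hne m hr.2.1.1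
        have n3 := hne l' hq.2.2.1
        have h4 : l = m := by
          field_simp at h1
          exact h1.symm
        subst h4
        have h5 := mul_left_cancel₀ n1 h2
        rw [h5]
    rw [card_sigma (V / V)] at this
    exact_mod_cast this
  obtain ⟨h, hh, hNh⟩ : ∃ h ∈ V / V, (#B : ℝ) * #V ≤ Λ * #(N h) := by
    have hVVne : (V / V).Nonempty := hVne.div hVne
    have hVVpos : (0 : ℝ) < #(V / V) := by exact_mod_cast hVVne.card_pos
    apply exists_le_of_sum_le hVVne
    rw [sum_const, nsmul_eq_mul, ← mul_sum]
    have c1 : (#B : ℝ) * #V ^ 2 ≤ 8 * L ^ 3 * L2 * ∑ h ∈ V / V, (#(N h) : ℝ) := by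
      refine hTc.trans ?_
      gcongr
    calc (#(V / V) : ℝ) * (#B * #V) ≤ (16 * L ^ 2 * κ ^ 2 * #V) * (#B * #V) := by gcongr
      _ = 16 * L ^ 2 * κ ^ 2 * (#B * #V ^ 2) := by ring
      _ ≤ 16 * L ^ 2 * κ ^ 2 * (8 * L ^ 3 * L2 * ∑ h ∈ V / V, (#(N h) : ℝ)) := by gcongr
      _ = _ := by rw [hΛ]; ring
  have hh0 : h ≠ 0 := by
    obtain ⟨a, ha, b, hb, rfl⟩ := mem_div.1 hh
    exact div_ne_zero (hne a ha) (hne b hb)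
  have hΛpos : 0 < Λ := by rw [hΛ]; positivity
  -- Cauchy-Schwarz
  set n : ZMod p → ℝ := fun a => #(V.filter (fun l => h * μ * a + l * (μ - 1) ∈ B)) with hn
  have hNn : (#(N h) : ℝ) = ∑ a ∈ B, n a := by
    simp only [hN, hn, card_filter, sum_product]
    push_cast
    rfl
  set cc : ZMod p × ZMod p → ℝ := fun q => #(B.filter (fun a => h * μ * a + q.1 * (μ - 1) ∈ B ∧
    h * μ * a + q.2 * (μ - 1) ∈ B)) with hcc
  have hnsq : ∑ a ∈ B, n a ^ 2 = ∑ q ∈ V ×ˢ V, cc q := by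
    rw [← dc B (V ×ˢ V) (fun a q => h * μ * a + q.1 * (μ - 1) ∈ B ∧
      h * μ * a + q.2 * (μ - 1) ∈ B)]
    refine sum_congr rfl fun a _ => ?_
    rw [filter_product (s := V) (t := V) (fun l => h * μ * a + l * (μ - 1) ∈ B)
      (fun l => h * μ * a + l * (μ - 1) ∈ B), card_product, sq]
    push_cast
    rfl
  have hCS : (∑ a ∈ B, n a) ^ 2 ≤ #B * ∑ a ∈ B, n a ^ 2 := sq_sum_le_card_mul_sum_sq
  have hsum : (#B / Λ ^ 2 : ℝ) * #(V ×ˢ V) ≤ ∑ q ∈ V ×ˢ V, cc q := by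
    rw [← hnsq, div_mul_eq_mul_div, div_le_iff₀ (by positivity)]
    refine le_of_mul_le_mul_left ?_ hBpos
    rw [card_product]
    push_cast
    calc (#B : ℝ) * (#B * (#V * #V)) = (#B * #V) ^ 2 := by ring
      _ ≤ (Λ * ∑ a ∈ B, n a) ^ 2 := by
        rw [← hNn]
        gcongr
      _ = Λ ^ 2 * (∑ a ∈ B, n a) ^ 2 := by ring
      _ ≤ Λ ^ 2 * (#B * ∑ a ∈ B, n a ^ 2) := by gcongr
      _ = _ := by ring
  have hpop := popular (V ×ˢ V) cc #B (#B / Λ ^ 2) (by positivity)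
    (fun q _ => by simp only [hcc]; exact_mod_cast card_filter_le _ _) hsum
  set G := (V ×ˢ V).filter (fun q => (#B / Λ ^ 2 : ℝ) ≤ 2 * cc q) with hG
  have hGc : #G ≤ #V * #(AS (2 * Λ ^ 2) B) := by
    rw [← card_product]
    apply card_le_card_of_injOn (fun q => (q.1, (q.1 - q.2) * (μ - 1)))
    · rintro ⟨l, l'⟩ hq
      simp only [hG, mem_coe, mem_filter, mem_product] at hq
      simp only [mem_coe, mem_product]
      refine ⟨hq.1.1, ?_⟩
      rw [mem_AS]
      have e := hq.2
      rw [div_le_iff₀ (by positivity)] at e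
      have e2 : cc (l, l') ≤ ar B ((l - l') * (μ - 1)) := by
        simp only [hcc, ar]
        norm_cast
        apply card_le_card_of_injOn (fun a => h * μ * a + l' * (μ - 1))
        · intro a ha
          simp only [mem_coe, mem_filter] at ha ⊢
          refine ⟨ha.2.2, ?_⟩
          have : h * μ * a + l' * (μ - 1) + (l - l') * (μ - 1) = h * μ * a + l * (μ - 1) := by ring
          rw [this]; exact ha.2.1
        · intro a _ b _ hab
          exact mul_left_cancel₀ (mul_ne_zero hh0 hμ0) (add_right_cancel hab)
      have : 0 ≤ Λ ^ 2 := by positivity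
      nlinarith
    · rintro ⟨l, l'⟩ _ ⟨m, m'⟩ _ hlm
      simp only [Prod.mk.injEq] at hlm ⊢
      obtain ⟨rfl, h2⟩ := hlm
      have := mul_right_cancel₀ (sub_ne_zero.2 hμ1) h2
      exact ⟨rfl, by linear_combination -this⟩
  have hGc' : (#G : ℝ) ≤ #V * #(AS (2 * Λ ^ 2) B) := by exact_mod_cast hGc
  rw [card_product] at hpop
  push_cast at hpop
  have f1 : (#V : ℝ) ≤ 2 * Λ ^ 2 * #(AS (2 * Λ ^ 2) B) := by
    have e : (#B / Λ ^ 2 : ℝ) * (#V * #V) = (#B * (#V * #V)) / Λ ^ 2 := by ring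
    rw [e, div_le_iff₀ (by positivity)] at hpop
    have e2 : (#B : ℝ) * #V * #V ≤ (#B : ℝ) * #V * (2 * Λ ^ 2 * #(AS (2 * Λ ^ 2) B)) := by
      calc (#B : ℝ) * #V * #V = #B * (#V * #V) := by ring
        _ ≤ _ := hpop
        _ ≤ 2 * #B * (#V * #(AS (2 * Λ ^ 2) B)) * Λ ^ 2 := by gcongr
        _ = _ := by ring
    exact le_of_mul_le_mul_left e2 (by positivity)
  calc (#P : ℝ) ≤ 4 * L * #V := hV
    _ ≤ 4 * L * (2 * Λ ^ 2 * #(AS (2 * Λ ^ 2) B)) := by gcongr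
    _ = _ := by ring

end SP

namespace SP
open Finset
open scoped Pointwise

lemma smul_fsub {p : ℕ} (c : ZMod p) (A C : Finset (ZMod p)) :
    c • (A - C) = c • A - c • C := by
  ext x
  simp only [mem_smul_finset, mem_sub, smul_eq_mul]
  constructor
  · rintro ⟨y, ⟨a, ha, b, hb, rfl⟩, rfl⟩
    exact ⟨_, ⟨a, ha, rfl⟩, _, ⟨b, hb, rfl⟩, by ring⟩
  · rintro ⟨_, ⟨a, ha, rfl⟩, _, ⟨b, hb, rfl⟩, rfl⟩
    exact ⟨_, ⟨a, ha, b, hb, rfl⟩, by ring⟩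

lemma smul_fadd {p : ℕ} (c : ZMod p) (A C : Finset (ZMod p)) :
    c • (A + C) = c • A + c • C := by
  ext x
  simp only [mem_smul_finset, mem_add, smul_eq_mul]
  constructor
  · rintro ⟨y, ⟨a, ha, b, hb, rfl⟩, rfl⟩
    exact ⟨_, ⟨a, ha, rfl⟩, _, ⟨b, hb, rfl⟩, by ring⟩
  · rintro ⟨_, ⟨a, ha, rfl⟩, _, ⟨b, hb, rfl⟩, rfl⟩
    exact ⟨_, ⟨a, ha, b, hb, rfl⟩, by ring⟩

lemma ar_sub {p : ℕ} {B B' : Finset (ZMod p)} (h : B' ⊆ B) (d : ZMod p) : ar B' d ≤ ar B d := by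
  unfold ar
  apply card_le_card
  intro b hb
  rw [mem_filter] at *
  exact ⟨h hb.1, h hb.2⟩

/-- Ruzsa-triangle step. -/
lemma ruzsa_step {p : ℕ} [Fact p.Prime] (V V' : Finset (ZMod p)) (z D d : ℝ)
    (hd : 0 < d) (hz : 0 < z) (hD : 0 ≤ D)
    (h1 : (#(V - V) : ℝ) ≤ D * z) (h2 : (#(V' - V') : ℝ) ≤ D * z) (h3 : z ≤ d * #(V' ∩ V)) :
    (#(V - V') : ℝ) ≤ d * D ^ 2 * z := by
  have hr := Finset.ruzsa_triangle_inequality_sub_sub_sub V (V' ∩ V) V'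
  have a1 : #(V - V' ∩ V) ≤ #(V - V) := card_le_card (sub_subset_sub_left inter_subset_right)
  have a2 : #(V' - V' ∩ V) ≤ #(V' - V') := card_le_card (sub_subset_sub_left inter_subset_left)
  have a3 : (#(V - V') : ℝ) * #(V' ∩ V) ≤ (D * z) * (D * z) := by
    calc (#(V - V') : ℝ) * #(V' ∩ V) ≤ #(V - V' ∩ V) * #(V' - V' ∩ V) := by exact_mod_cast hr
      _ ≤ #(V - V) * #(V' - V') := by gcongr
      _ ≤ _ := by gcongr
  have a4 : (#(V - V') : ℝ) * z ≤ (d * D ^ 2 * z) * z := by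
    calc (#(V - V') : ℝ) * z ≤ #(V - V') * (d * #(V' ∩ V)) := by gcongr
      _ = d * (#(V - V') * #(V' ∩ V)) := by ring
      _ ≤ d * ((D * z) * (D * z)) := by gcongr
      _ = _ := by ring
  exact le_of_mul_le_mul_right a4 hz

open Classical in
lemma ring_input {p : ℕ} [Fact p.Prime] (B : Finset (ZMod p)) (hB : B.Nonempty)
    (L0 L1 Ls κ : ℝ) (hL1 : 1 ≤ L1) (hLs : 1 ≤ Ls) (hκ0 : 0 < κ) (hL0 : 32 * L1 ^ 2 * Ls ≤ L0)
    (X0 : Finset (ZMod p)) (hX0 : X0.Nonempty) (hXMS : X0 ⊆ MS Ls B)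
    (hκ : ∀ B' ⊆ B, (#B : ℝ) ≤ Ls * #B' → (#(AS L0 B) : ℝ) ≤ κ * #(AS L1 B'))
    (Δ : ℝ) (hΔ : Δ = 4 * L1 * κ) :
    ∃ V X : Finset (ZMod p), V.Nonempty ∧ V ⊆ AS L0 B ∧ (#(AS L0 B) : ℝ) ≤ Δ * #V ∧
      (∀ ξ ∈ X, ξ ≠ 0) ∧ (#X0 : ℝ) ≤ 2 * Δ ^ 4 * #X ∧
      ∀ ξ ∈ X, (#(V - ξ • V) : ℝ) ≤ 4 * Δ ^ 14 * #V := by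
  set Z := AS L0 B with hZ
  have hΔpos : 0 < Δ := by rw [hΔ]; positivity
  have hL01 : 1 ≤ L0 := by nlinarith [mul_nonneg (by linarith : (0:ℝ) ≤ L1 - 1) (by linarith : (0:ℝ) ≤ Ls - 1), sq_nonneg L1]
  have hZpos : (0 : ℝ) < #Z := by
    have : 0 < #Z := card_pos.2 ⟨0, zero_mem_AS hL01 B⟩
    exact_mod_cast this
  have hBpos : (0 : ℝ) < #B := by exact_mod_cast hB.card_pos
  have main : ∀ l ∈ X0, ∃ V ⊆ Z, l • V ⊆ Z ∧ (#Z : ℝ) ≤ Δ * #V ∧ (#(V - V) : ℝ) ≤ Δ * #Z := by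
    intro l hl
    obtain ⟨hl0, hlB⟩ := mem_MS.1 (hXMS hl)
    set B' := B.filter (fun b => l * b ∈ B) with hB'
    have hlB' : (#B : ℝ) ≤ Ls * #B' := hlB
    have hB'ne : B'.Nonempty := by
      rw [nonempty_iff_ne_empty]
      intro h
      rw [h] at hlB'
      simp at hlB'
      rw [hlB'] at hB
      exact not_nonempty_empty hB
    have hsub : B' ⊆ B := filter_subset _ _
    have hASsub : ∀ L, 0 ≤ L → L * Ls ≤ L0 → AS L B' ⊆ Z := by
      intro L hL hLL d hd
      rw [mem_AS] at hd
      rw [hZ, mem_AS]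
      have : (ar B' d : ℝ) ≤ ar B d := by exact_mod_cast ar_sub hsub d
      calc (#B : ℝ) ≤ Ls * #B' := hlB'
        _ ≤ Ls * (L * ar B' d) := by gcongr
        _ ≤ Ls * (L * ar B d) := by gcongr
        _ = (L * Ls) * ar B d := by ring
        _ ≤ _ := by gcongr
    have hL1L0 : L1 * Ls ≤ L0 := by
      refine le_trans ?_ hL0
      gcongr
      nlinarith
    obtain ⟨V, hVW, hV1, hV2⟩ := bsg_add hL1 B' hB'ne (AS L1 B') le_rfl
      ⟨0, zero_mem_AS hL1 B'⟩
    have hW := hκ B' hsub hlB'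
    refine ⟨V, hVW.trans (hASsub L1 (by linarith) hL1L0), ?_, ?_, ?_⟩
    · intro z hz
      obtain ⟨d, hd, rfl⟩ := mem_smul_finset.1 hz
      have hd' := mem_AS.1 (hVW hd)
      rw [hZ, mem_AS, smul_eq_mul]
      have : ar B' d ≤ ar B (l * d) := by
        unfold ar
        apply card_le_card_of_injOn (fun b => l * b)
        · intro b hb
          simp only [hB', mem_coe, mem_filter] at hb ⊢
          refine ⟨hb.1.2, ?_⟩
          rw [← mul_add]; exact hb.2.2
        · intro a _ b _ h
          exact mul_left_cancel₀ hl0 h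
      have : (ar B' d : ℝ) ≤ ar B (l * d) := by exact_mod_cast this
      calc (#B : ℝ) ≤ Ls * #B' := hlB'
        _ ≤ Ls * (L1 * ar B' d) := by gcongr
        _ ≤ Ls * (L1 * ar B (l * d)) := by gcongr
        _ = (L1 * Ls) * ar B (l * d) := by ring
        _ ≤ _ := by gcongr
    · rw [hΔ]
      calc (#Z : ℝ) ≤ κ * #(AS L1 B') := hW
        _ ≤ κ * (4 * L1 * #V) := by gcongr
        _ = _ := by ring
    · have h32 : (#(AS (32 * L1 ^ 2) B') : ℝ) ≤ #Z := by
        exact_mod_cast card_le_card (hASsub (32 * L1 ^ 2) (by positivity) hL0)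
      have : (#(V - V) : ℝ) * #Z ≤ (Δ * #Z) * #Z := by
        calc (#(V - V) : ℝ) * #Z ≤ #(V - V) * (κ * #(AS L1 B')) := by gcongr
          _ = κ * (#(V - V) * #(AS L1 B')) := by ring
          _ ≤ κ * (4 * L1 * #(AS (32 * L1 ^ 2) B') ^ 2) := by gcongr
          _ ≤ κ * (4 * L1 * #Z ^ 2) := by gcongr
          _ = _ := by rw [hΔ]; ring
      exact le_of_mul_le_mul_right this hZpos
  choose! Vf hVZ hlV hVc hVV using main
  have hne : ∀ l ∈ X0, l ≠ 0 := fun l hl => (mem_MS.1 (hXMS hl)).1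
  set E : ZMod p → Finset (ZMod p × ZMod p) := fun l => Vf l ×ˢ (l • Vf l) with hE
  have hEc : ∀ l ∈ X0, (#Z : ℝ) ^ 2 ≤ Δ ^ 2 * #(E l) := by
    intro l hl
    rw [hE]
    simp only
    rw [card_product, card_smul_finset₀ (hne l hl)]
    push_cast
    calc (#Z : ℝ) ^ 2 ≤ (Δ * #(Vf l)) ^ 2 := by
          gcongr
          exact hVc l hl
      _ = _ := by ring
  have hEZ : ∀ l ∈ X0, E l ⊆ Z ×ˢ Z := fun l hl => product_subset_product (hVZ l hl) (hlV l hl)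
  have hXpos : (0 : ℝ) < #X0 := by exact_mod_cast hX0.card_pos
  -- Cauchy Schwarz
  set n : ZMod p × ZMod p → ℝ := fun z => #(X0.filter (fun l => z ∈ E l)) with hn
  have s1 : ∑ z ∈ Z ×ˢ Z, n z = ∑ l ∈ X0, (#(E l) : ℝ) := by
    rw [hn, dc (Z ×ˢ Z) X0 (fun z l => z ∈ E l)]
    refine sum_congr rfl fun l hl => ?_
    rw [filter_mem_eq_inter, inter_eq_right.2 (hEZ l hl)]
  have s2 : ∑ z ∈ Z ×ˢ Z, n z ^ 2 = ∑ l0 ∈ X0, ∑ l ∈ X0, (#(E l ∩ E l0) : ℝ) := by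
    have : ∀ z ∈ Z ×ˢ Z, n z ^ 2 = ∑ l0 ∈ X0, if z ∈ E l0 then n z else 0 := by
      intro z _
      rw [← sum_filter, sum_const, nsmul_eq_mul, sq]
    rw [sum_congr rfl this, sum_comm]
    refine sum_congr rfl fun l0 hl0 => ?_
    rw [← sum_filter, filter_mem_eq_inter, inter_eq_right.2 (hEZ l0 hl0), hn,
      dc (E l0) X0 (fun z l => z ∈ E l)]
    refine sum_congr rfl fun l hl => ?_
    rw [filter_mem_eq_inter, inter_comm]
  have hCS : (∑ z ∈ Z ×ˢ Z, n z) ^ 2 ≤ #(Z ×ˢ Z) * ∑ z ∈ Z ×ˢ Z, n z ^ 2 :=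
    sq_sum_le_card_mul_sum_sq
  have s3 : (#X0 : ℝ) * #Z ^ 2 ≤ Δ ^ 2 * ∑ z ∈ Z ×ˢ Z, n z := by
    rw [s1, mul_sum]
    calc (#X0 : ℝ) * #Z ^ 2 = ∑ l ∈ X0, (#Z : ℝ) ^ 2 := by simp
      _ ≤ _ := sum_le_sum hEc
  obtain ⟨l0, hl0, hsum⟩ : ∃ l0 ∈ X0, (#Z ^ 2 / Δ ^ 4 : ℝ) * #X0 ≤
      ∑ l ∈ X0, (#(E l ∩ E l0) : ℝ) := by
    apply exists_le_of_sum_le hX0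
    rw [← s2, sum_const, nsmul_eq_mul]
    have : (#X0 : ℝ) * (#Z ^ 2 / Δ ^ 4 * #X0) = (#X0 * (#Z ^ 2 * #X0)) / Δ ^ 4 := by ring
    rw [this, div_le_iff₀ (by positivity)]
    rw [card_product] at hCS
    push_cast at hCS
    have hz : (0:ℝ) < #Z ^ 2 := by positivity
    refine le_of_mul_le_mul_left ?_ hz
    calc (#Z : ℝ) ^ 2 * (#X0 * (#Z ^ 2 * #X0)) = (#X0 * #Z ^ 2) ^ 2 := by ring
      _ ≤ (Δ ^ 2 * ∑ z ∈ Z ×ˢ Z, n z) ^ 2 := by gcongr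
      _ = Δ ^ 4 * (∑ z ∈ Z ×ˢ Z, n z) ^ 2 := by ring
      _ ≤ Δ ^ 4 * (#Z * #Z * ∑ z ∈ Z ×ˢ Z, n z ^ 2) := by gcongr
      _ = _ := by ring
  have hpop := popular X0 (fun l => (#(E l ∩ E l0) : ℝ)) (#Z ^ 2) (#Z ^ 2 / Δ ^ 4) (by positivity)
    (fun l hl => by
      have : #(E l ∩ E l0) ≤ #(Z ×ˢ Z) := card_le_card (inter_subset_left.trans (hEZ l hl))
      rw [card_product, ← sq] at this
      exact_mod_cast this) hsum
  set X1 := X0.filter (fun l => (#Z ^ 2 / Δ ^ 4 : ℝ) ≤ 2 * #(E l ∩ E l0)) with hX1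
  have hl00 := hne l0 hl0
  set V := Vf l0 with hV
  refine ⟨V, X1.image (fun l => l0 / l), ?_, hVZ l0 hl0, hVc l0 hl0, ?_, ?_, ?_⟩
  · rw [nonempty_iff_ne_empty]
    intro h
    have := hVc l0 hl0
    rw [← hV, h] at this
    simp at this
    have h3 : #Z = 0 := by rw [this]; simp
    rw [h3] at hZpos; simp at hZpos
  · intro ξ hξ
    obtain ⟨l, hl, rfl⟩ := mem_image.1 hξ
    exact div_ne_zero hl00 (hne l (mem_filter.1 hl).1)
  · rw [card_image_of_injOn]
    · have e : (#Z ^ 2 / Δ ^ 4 : ℝ) * #X0 = (#Z ^ 2 * #X0) / Δ ^ 4 := by ring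
      rw [e, div_le_iff₀ (by positivity)] at hpop
      have hz : (0:ℝ) < #Z ^ 2 := by positivity
      refine le_of_mul_le_mul_left ?_ hz
      linarith
    · intro a ha b hb hab
      simp only at hab
      have := hne a (mem_filter.1 ha).1
      have := hne b (mem_filter.1 hb).1
      field_simp at hab
      exact hab.symm
  · intro ξ hξ
    obtain ⟨l, hl, rfl⟩ := mem_image.1 hξ
    obtain ⟨hlX, hlE⟩ := mem_filter.1 hl
    have hl0' := hne l hlX
    rw [div_le_iff₀ (by positivity)] at hlE
    have hinter : (#(E l ∩ E l0) : ℝ) = #(Vf l ∩ V) * #(l • Vf l ∩ l0 • V) := by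
      simp only [hE]
      rw [product_inter_product, card_product]
      push_cast; rfl
    have k1 : (#(Vf l ∩ V) : ℝ) ≤ #Z := by
      exact_mod_cast card_le_card (inter_subset_left.trans (hVZ l hlX))
    have k2 : (#(l • Vf l ∩ l0 • V) : ℝ) ≤ #Z := by
      exact_mod_cast card_le_card (inter_subset_left.trans (hlV l hlX))
    rw [hinter] at hlE
    have k3 : (#Z : ℝ) ≤ 2 * Δ ^ 4 * #(Vf l ∩ V) := by
      refine le_of_mul_le_mul_right ?_ hZpos
      calc (#Z : ℝ) * #Z = #Z ^ 2 := by ring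
        _ ≤ _ := hlE
        _ ≤ 2 * (#(Vf l ∩ V) * #Z) * Δ ^ 4 := by gcongr
        _ = _ := by ring
    have k4 : (#Z : ℝ) ≤ 2 * Δ ^ 4 * #(l • Vf l ∩ l0 • V) := by
      refine le_of_mul_le_mul_right ?_ hZpos
      calc (#Z : ℝ) * #Z = #Z ^ 2 := by ring
        _ ≤ _ := hlE
        _ ≤ 2 * (#Z * #(l • Vf l ∩ l0 • V)) * Δ ^ 4 := by gcongr
        _ = _ := by ring
    have m1 : (#(V - Vf l) : ℝ) ≤ 2 * Δ ^ 4 * Δ ^ 2 * #Z :=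
      ruzsa_step V (Vf l) #Z Δ (2 * Δ ^ 4) (by positivity) hZpos hΔpos.le (hVV l0 hl0)
        (hVV l hlX) k3
    have m2 : (#(l0 • V - l • Vf l) : ℝ) ≤ 2 * Δ ^ 4 * Δ ^ 2 * #Z := by
      apply ruzsa_step (l0 • V) (l • Vf l) #Z Δ (2 * Δ ^ 4) (by positivity) hZpos hΔpos.le _ _ k4
      · rw [← smul_fsub, card_smul_finset₀ hl00]; exact hVV l0 hl0
      · rw [← smul_fsub, card_smul_finset₀ hl0']; exact hVV l hlX
    have m3 : #((l0 / l) • V - Vf l) = #(l0 • V - l • Vf l) := by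
      rw [← card_smul_finset₀ hl0' ((l0 / l) • V - Vf l), smul_fsub, smul_smul]
      congr 3
      field_simp
    have hr := Finset.ruzsa_triangle_inequality_sub_sub_sub V (Vf l) ((l0 / l) • V)
    rw [m3] at hr
    have hr' : (#(V - (l0 / l) • V) : ℝ) * #(Vf l) ≤ #(V - Vf l) * #(l0 • V - l • Vf l) := by
      exact_mod_cast hr
    refine le_of_mul_le_mul_right ?_ hZpos
    calc (#(V - (l0 / l) • V) : ℝ) * #Z ≤ #(V - (l0 / l) • V) * (Δ * #(Vf l)) := by
          gcongr
          exact hVc l hlX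
      _ = Δ * (#(V - (l0 / l) • V) * #(Vf l)) := by ring
      _ ≤ Δ * (#(V - Vf l) * #(l0 • V - l • Vf l)) := by gcongr
      _ ≤ Δ * ((2 * Δ ^ 4 * Δ ^ 2 * #Z) * (2 * Δ ^ 4 * Δ ^ 2 * #Z)) := by gcongr
      _ = 4 * Δ ^ 13 * #Z * #Z := by ring
      _ ≤ 4 * Δ ^ 13 * (Δ * #V) * #Z := by
          gcongr
          exact hVc l0 hl0
      _ = _ := by ring

end SP

namespace SP
open Finset
open scoped Pointwise

lemma pivot_energy {p : ℕ} [Fact p.Prime] (X : Finset (ZMod p)) (hX : X.Nonempty)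
    (hXp : #X ^ 2 < p) :
    ∃ ξ : ZMod p, ξ ≠ 0 ∧ #X ^ 2 ≤ 2 * #(X + ξ • X) := by
  classical
  set F := (univ : Finset (ZMod p)).erase 0 with hF
  have hFc : #F = p - 1 := by
    rw [hF, card_erase_of_mem (mem_univ _), card_univ, ZMod.card]
  have hp2 : 2 ≤ p := (Fact.out : p.Prime).two_le
  set Q := (X ×ˢ X) ×ˢ (X ×ˢ X) with hQ
  set r : ZMod p → (ZMod p × ZMod p) × (ZMod p × ZMod p) → Prop :=
    fun ξ q => q.1.1 + ξ * q.2.1 = q.1.2 + ξ * q.2.2 with hr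
  have hE : ∀ ξ ∈ F, addEnergy X (ξ • X) ≤ #(Q.filter (fun q => r ξ q)) := by
    intro ξ hξ
    have hξ0 : ξ ≠ 0 := (mem_erase.1 hξ).1
    unfold addEnergy
    apply card_le_card_of_injOn (fun q => (q.1, (ξ⁻¹ * q.2.1, ξ⁻¹ * q.2.2)))
    · rintro ⟨⟨a, a'⟩, ⟨b, b'⟩⟩ hq
      simp only [mem_coe, mem_filter, mem_product, mem_smul_finset, smul_eq_mul] at hq
      obtain ⟨⟨⟨ha, ha'⟩, ⟨c, hc, rfl⟩, ⟨c', hc', rfl⟩⟩, h⟩ := hq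
      simp only [mem_coe, mem_filter, hQ, mem_product, hr]
      have e1 : ξ⁻¹ * (ξ * c) = c := by field_simp
      have e2 : ξ⁻¹ * (ξ * c') = c' := by field_simp
      rw [e1, e2]
      exact ⟨⟨⟨ha, ha'⟩, hc, hc'⟩, h⟩
    · rintro ⟨⟨a, a'⟩, ⟨b, b'⟩⟩ _ ⟨⟨c, c'⟩, ⟨d, d'⟩⟩ _ h
      simp only [Prod.mk.injEq] at h ⊢
      exact ⟨h.1, mul_left_cancel₀ (inv_ne_zero hξ0) h.2.1,
        mul_left_cancel₀ (inv_ne_zero hξ0) h.2.2⟩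
  have hsum : ∑ ξ ∈ F, #(Q.filter (fun q => r ξ q)) ≤ (p - 1) * #X ^ 2 + #X ^ 4 := by
    have h1 : ∑ ξ ∈ F, #(Q.filter (fun q => r ξ q)) = ∑ q ∈ Q, #(F.filter (fun ξ => r ξ q)) :=
      sum_card_bipartiteAbove_eq_sum_card_bipartiteBelow r
    rw [h1]
    set Dg : Finset ((ZMod p × ZMod p) × (ZMod p × ZMod p)) :=
      Q.filter (fun q => q.1.1 = q.1.2 ∧ q.2.1 = q.2.2) with hDg
    have h2 : ∀ q ∈ Q, #(F.filter (fun ξ => r ξ q)) ≤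
        (if q.1.1 = q.1.2 ∧ q.2.1 = q.2.2 then (p - 1) else 0) + 1 := by
      rintro ⟨⟨a, a'⟩, ⟨b, b'⟩⟩ _
      split_ifs with h
      · refine (card_filter_le _ _).trans ?_
        omega
      · rw [zero_add, card_le_one]
        intro x hx y hy
        simp only [mem_filter, hr, hF, mem_erase] at hx hy
        simp only at h
        by_cases hb : b = b'
        · subst hb
          exact absurd ⟨add_right_cancel hx.2, rfl⟩ h
        · have hb' : b - b' ≠ 0 := sub_ne_zero.2 hb
          apply mul_right_cancel₀ hb'
          linear_combination hx.2 - hy.2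
    refine (sum_le_sum h2).trans ?_
    rw [sum_add_distrib, ← sum_filter, sum_const, sum_const, smul_eq_mul, smul_eq_mul, mul_one]
    have h3 : #Dg ≤ #X ^ 2 := by
      rw [sq, ← card_product]
      apply card_le_card_of_injOn (fun q => (q.1.1, q.2.1))
      · rintro ⟨⟨a, a'⟩, ⟨b, b'⟩⟩ hq
        simp only [hDg, hQ, mem_coe, mem_filter, mem_product] at hq ⊢
        exact ⟨hq.1.1.1, hq.1.2.1⟩
      · rintro ⟨⟨a, a'⟩, ⟨b, b'⟩⟩ hq ⟨⟨c, c'⟩, ⟨d, d'⟩⟩ hq' h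
        simp only [hDg, hQ, mem_coe, mem_filter, mem_product] at hq hq'
        simp only [Prod.mk.injEq] at h ⊢
        obtain ⟨rfl, rfl⟩ := h
        exact ⟨⟨rfl, hq.2.1 ▸ hq'.2.1⟩, ⟨rfl, hq.2.2 ▸ hq'.2.2⟩⟩
    have h4 : #Q = #X ^ 4 := by
      rw [hQ]; simp only [card_product]; ring
    rw [h4, mul_comm]
    gcongr
  obtain ⟨ξ, hξ, hξE⟩ : ∃ ξ ∈ F, #(Q.filter (fun q => r ξ q)) ≤ 2 * #X ^ 2 := by
    have hFne : F.Nonempty := card_pos.1 (by omega)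
    apply exists_le_of_sum_le hFne
    refine hsum.trans ?_
    rw [sum_const, smul_eq_mul, hFc]
    have : #X ^ 4 ≤ (p - 1) * #X ^ 2 := by
      calc #X ^ 4 = #X ^ 2 * #X ^ 2 := by ring
        _ ≤ _ := by
          gcongr
          omega
    linarith
  have hξ0 : ξ ≠ 0 := (mem_erase.1 hξ).1
  refine ⟨ξ, hξ0, ?_⟩
  have := le_card_add_mul_addEnergy X (ξ • X)
  rw [card_smul_finset₀ hξ0] at this
  have hX2 : 0 < #X ^ 2 := by have := hX.card_pos; positivity
  have h5 : #X ^ 2 * #X ^ 2 ≤ #X ^ 2 * (2 * #(X + ξ • X)) := by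
    calc #X ^ 2 * #X ^ 2 ≤ _ := this
      _ ≤ #(X + ξ • X) * (2 * #X ^ 2) := by
        gcongr
        exact (hE ξ hξ).trans hξE
      _ = _ := by ring
  exact le_of_mul_le_mul_left h5 hX2

lemma pivot {p : ℕ} [Fact p.Prime] (X : Finset (ZMod p)) (hX : 2 ≤ #X) (hXp : #X ^ 2 < p) :
    ∃ S : Finset (ZMod p), #X ^ 2 ≤ 2 * #S ∧ #S ≤ #X ^ 2 ∧
      ∃ x1 ∈ X, ∃ x2 ∈ X, ∃ x3 ∈ X, ∃ x4 ∈ X, ∀ s ∈ S, ∃ a ∈ X, ∃ b ∈ X,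
        s = (x3 - x4) * a + (x1 - x2) * b ∨
        s = (x3 - x4) * a + (x1 - x2 + (x3 - x4)) * b := by
  classical
  obtain ⟨u, hu, v, hv, huv⟩ := one_lt_card.1 (by omega : 1 < #X)
  have hXne : X.Nonempty := ⟨u, hu⟩
  -- ratios
  by_cases hR : ∀ ξ : ZMod p, ∃ x1 ∈ X, ∃ x2 ∈ X, ∃ x3 ∈ X, ∃ x4 ∈ X, x3 ≠ x4 ∧
      ξ * (x3 - x4) = x1 - x2
  · obtain ⟨ξ, hξ0, hξ⟩ := pivot_energy X hXne hXp
    obtain ⟨x1, h1, x2, h2, x3, h3, x4, h4, hne, he⟩ := hR ξ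
    have hne' : x3 - x4 ≠ 0 := sub_ne_zero.2 hne
    refine ⟨(x3 - x4) • (X + ξ • X), ?_, ?_, x1, h1, x2, h2, x3, h3, x4, h4, ?_⟩
    · rwa [card_smul_finset₀ hne']
    · rw [card_smul_finset₀ hne']
      refine (card_add_le).trans ?_
      rw [card_smul_finset₀ hξ0, sq]
    · intro s hs
      obtain ⟨t, ht, rfl⟩ := mem_smul_finset.1 hs
      obtain ⟨a, ha, b', hb', rfl⟩ := mem_add.1 ht
      obtain ⟨b, hb, rfl⟩ := mem_smul_finset.1 hb'
      refine ⟨a, ha, b, hb, Or.inl ?_⟩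
      rw [← he]
      simp only [smul_eq_mul]; ring
  · set R : ZMod p → Prop := fun ξ => ∃ x1 ∈ X, ∃ x2 ∈ X, ∃ x3 ∈ X, ∃ x4 ∈ X, x3 ≠ x4 ∧
      ξ * (x3 - x4) = x1 - x2 with hRdef
    have hR0 : R 0 := ⟨u, hu, u, hu, u, hu, v, hv, huv, by ring⟩
    obtain ⟨ξ, hξ, hξ1⟩ : ∃ ξ, R ξ ∧ ¬ R (ξ + 1) := by
      by_contra hc
      push Not at hc
      apply hR
      have : ∀ n : ℕ, R (n : ZMod p) := by
        intro n
        induction n with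
        | zero => simpa using hR0
        | succ m ih => push_cast; exact hc _ ih
      intro ξ
      have h := this ξ.val
      rw [ZMod.natCast_zmod_val] at h
      exact h
    obtain ⟨x1, h1, x2, h2, x3, h3, x4, h4, hne, he⟩ := hξ
    have hne' : x3 - x4 ≠ 0 := sub_ne_zero.2 hne
    have hcard : #((X ×ˢ X).image (fun q => (x3 - x4) * q.1 + (x1 - x2 + (x3 - x4)) * q.2))
        = #X ^ 2 := by
      rw [card_image_of_injOn, card_product, sq]
      rintro ⟨a, b⟩ hq ⟨c, d⟩ hr h
      simp only [mem_coe, mem_product] at hq hr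
      simp only at h
      by_cases hbd : b = d
      · subst hbd
        have := mul_left_cancel₀ hne' (add_right_cancel h)
        rw [this]
      · exfalso
        apply hξ1
        refine ⟨c, hr.1, a, hq.1, b, hq.2, d, hr.2, hbd, ?_⟩
        apply mul_left_cancel₀ hne'
        linear_combination h + (b - d) * he
    refine ⟨(X ×ˢ X).image (fun q => (x3 - x4) * q.1 + (x1 - x2 + (x3 - x4)) * q.2),
      by omega, by omega, x1, h1, x2, h2, x3, h3, x4, h4, ?_⟩
    intro s hs
    obtain ⟨⟨a, b⟩, hab, rfl⟩ := mem_image.1 hs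
    rw [mem_product] at hab
    exact ⟨a, hab.1, b, hab.2, Or.inr rfl⟩

end SP

namespace SP
open Finset
open scoped Pointwise

/-- `ξ • V` is covered by at most `k` translates of `V - V`. -/
def Good {p : ℕ} (V : Finset (ZMod p)) (k : ℝ) (ξ : ZMod p) : Prop :=
  ∃ F : Finset (ZMod p), (#F : ℝ) ≤ k ∧ ξ • V ⊆ F + (V - V)

/-- `V - V` has the doubling covering property. -/
def Cov {p : ℕ} (V : Finset (ZMod p)) (M : ℝ) : Prop :=
  ∃ F : Finset (ZMod p), (#F : ℝ) ≤ M ∧ ∀ a ∈ V - V, ∀ b ∈ V - V, a + b ∈ F + (V - V) ∧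
    a - b ∈ F + (V - V)

lemma card_add_le3 {p : ℕ} (F G H : Finset (ZMod p)) :
    (#(F + G + H) : ℝ) ≤ #F * #G * #H := by
  have h1 := card_add_le (s := F + G) (t := H)
  have h2 := card_add_le (s := F) (t := G)
  exact_mod_cast h1.trans (Nat.mul_le_mul_right _ h2)

lemma Good.mono {p : ℕ} {V : Finset (ZMod p)} {k k' : ℝ} {ξ : ZMod p} (h : Good V k ξ)
    (hk : k ≤ k') : Good V k' ξ := by
  obtain ⟨F, h1, h2⟩ := h
  exact ⟨F, h1.trans hk, h2⟩

lemma Good.add {p : ℕ} {V : Finset (ZMod p)} {k k' M : ℝ} {ξ ξ' : ZMod p} (hM : Cov V M)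
    (h : Good V k ξ) (h' : Good V k' ξ') : Good V (k * k' * M) (ξ + ξ') := by
  obtain ⟨F, h1, h2⟩ := h
  obtain ⟨F', h1', h2'⟩ := h'
  obtain ⟨G, hG1, hG2⟩ := hM
  refine ⟨F + F' + G, (card_add_le3 F F' G).trans ?_, ?_⟩
  · have a1 : (0:ℝ) ≤ #F := by positivity
    have a2 : (0:ℝ) ≤ #F' := by positivity
    have a3 : 0 ≤ k := a1.trans h1
    have a4 : 0 ≤ k' := a2.trans h1'
    gcongr
  · intro z hz
    obtain ⟨v, hv, rfl⟩ := mem_smul_finset.1 hz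
    obtain ⟨f, hf, d, hd, e⟩ := mem_add.1 (h2 (smul_mem_smul_finset hv))
    obtain ⟨f', hf', d', hd', e'⟩ := mem_add.1 (h2' (smul_mem_smul_finset hv))
    obtain ⟨g, hg, d2, hd2, e2⟩ := mem_add.1 (hG2 d hd d' hd').1
    refine mem_add.2 ⟨f + f' + g, add_mem_add (add_mem_add hf hf') hg, d2, hd2, ?_⟩
    simp only [smul_eq_mul] at e e' ⊢
    linear_combination e + e' + e2

lemma Good.sub {p : ℕ} {V : Finset (ZMod p)} {k k' M : ℝ} {ξ ξ' : ZMod p} (hM : Cov V M)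
    (h : Good V k ξ) (h' : Good V k' ξ') : Good V (k * k' * M) (ξ - ξ') := by
  obtain ⟨F, h1, h2⟩ := h
  obtain ⟨F', h1', h2'⟩ := h'
  obtain ⟨G, hG1, hG2⟩ := hM
  refine ⟨F + (-F') + G, (card_add_le3 F (-F') G).trans ?_, ?_⟩
  · rw [card_neg]
    have a1 : (0:ℝ) ≤ #F := by positivity
    have a2 : (0:ℝ) ≤ #F' := by positivity
    have a3 : 0 ≤ k := a1.trans h1
    have a4 : 0 ≤ k' := a2.trans h1'
    gcongr
  · intro z hz
    obtain ⟨v, hv, rfl⟩ := mem_smul_finset.1 hz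
    obtain ⟨f, hf, d, hd, e⟩ := mem_add.1 (h2 (smul_mem_smul_finset hv))
    obtain ⟨f', hf', d', hd', e'⟩ := mem_add.1 (h2' (smul_mem_smul_finset hv))
    obtain ⟨g, hg, d2, hd2, e2⟩ := mem_add.1 (hG2 d hd d' hd').2
    refine mem_add.2 ⟨f + -f' + g, add_mem_add (add_mem_add hf (neg_mem_neg hf')) hg, d2, hd2, ?_⟩
    simp only [smul_eq_mul] at e e' ⊢
    linear_combination e - e' + e2

lemma Good.mul {p : ℕ} {V : Finset (ZMod p)} {k k' M : ℝ} {ξ ξ' : ZMod p} (hM : Cov V M)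
    (h : Good V k ξ) (h' : Good V k' ξ') : Good V (k' * (k * k) * M) (ξ * ξ') := by
  obtain ⟨F, h1, h2⟩ := h
  obtain ⟨F', h1', h2'⟩ := h'
  obtain ⟨G, hG1, hG2⟩ := hM
  refine ⟨ξ • F' + (F - F) + G, (card_add_le3 _ _ _).trans ?_, ?_⟩
  · have a0 : (#(ξ • F') : ℝ) ≤ k' := by
      refine le_trans ?_ h1'
      exact_mod_cast card_image_le
    have a5 : (#(F - F) : ℝ) ≤ #F * #F := by exact_mod_cast card_sub_le
    have a1 : (0:ℝ) ≤ #F := by positivity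
    have a2 : (0:ℝ) ≤ #F' := by positivity
    have a3 : 0 ≤ k := a1.trans h1
    have a4 : 0 ≤ k' := a2.trans h1'
    have a6 : (#(F - F) : ℝ) ≤ k * k := a5.trans (by gcongr)
    gcongr
  · intro z hz
    obtain ⟨v, hv, rfl⟩ := mem_smul_finset.1 hz
    obtain ⟨f', hf', d', hd', e'⟩ := mem_add.1 (h2' (smul_mem_smul_finset hv))
    obtain ⟨w, hw, w', hw', ew⟩ := mem_sub.1 hd'
    obtain ⟨f1, hf1, d1, hd1, e1⟩ := mem_add.1 (h2 (smul_mem_smul_finset hw))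
    obtain ⟨f2, hf2, d2, hd2, e2⟩ := mem_add.1 (h2 (smul_mem_smul_finset hw'))
    obtain ⟨g, hg, d3, hd3, e3⟩ := mem_add.1 (hG2 d1 hd1 d2 hd2).2
    refine mem_add.2 ⟨ξ • f' + (f1 - f2) + g, add_mem_add (add_mem_add
      (smul_mem_smul_finset hf') (sub_mem_sub hf1 hf2)) hg, d3, hd3, ?_⟩
    simp only [smul_eq_mul] at e1 e2 e' ⊢
    linear_combination e3 + e1 - e2 + ξ * e' + ξ * ew

/-- one pivot round -/
lemma pivot_good {p : ℕ} [Fact p.Prime] {V : Finset (ZMod p)} {k M : ℝ} (hM : Cov V M)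
    (hM1 : 1 ≤ M) (hkM : M ≤ k) (X : Finset (ZMod p)) (hX : 2 ≤ #X) (hXp : #X ^ 2 < p)
    (hG : ∀ x ∈ X, Good V k x) :
    ∃ S : Finset (ZMod p), #X ^ 2 ≤ 2 * #S ∧ #S ≤ #X ^ 2 ∧ ∀ s ∈ S, Good V (k ^ 17) s := by
  obtain ⟨S, h1, h2, x1, hx1, x2, hx2, x3, hx3, x4, hx4, h⟩ := pivot X hX hXp
  refine ⟨S, h1, h2, ?_⟩
  have hk1 : 1 ≤ k := hM1.trans hkM
  have hk0 : 0 ≤ k := by linarith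
  have g1 : Good V (k ^ 3) (x3 - x4) := (Good.sub hM (hG x3 hx3) (hG x4 hx4)).mono (by
    calc k * k * M ≤ k * k * k := by gcongr
      _ = _ := by ring)
  have g2 : Good V (k ^ 3) (x1 - x2) := (Good.sub hM (hG x1 hx1) (hG x2 hx2)).mono (by
    calc k * k * M ≤ k * k * k := by gcongr
      _ = _ := by ring)
  have g3 : Good V (k ^ 7) (x1 - x2 + (x3 - x4)) := (Good.add hM g2 g1).mono (by
    calc k ^ 3 * k ^ 3 * M ≤ k ^ 3 * k ^ 3 * k := by gcongr
      _ = _ := by ring)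
  have g2' : Good V (k ^ 7) (x1 - x2) := g2.mono (pow_le_pow_right₀ hk1 (by norm_num))
  have fin : ∀ a ∈ X, ∀ b ∈ X, ∀ y, Good V (k ^ 7) y → Good V (k ^ 17) ((x3 - x4) * a + y * b) := by
    intro a ha b hb y hy
    have q1 : Good V (k ^ 6) ((x3 - x4) * a) := by
      rw [mul_comm]
      refine (Good.mul hM (hG a ha) g1).mono ?_
      calc k ^ 3 * (k * k) * M ≤ k ^ 3 * (k * k) * k := by gcongr
        _ = _ := by ring
    have q2 : Good V (k ^ 10) (y * b) := by
      rw [mul_comm]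
      refine (Good.mul hM (hG b hb) hy).mono ?_
      calc k ^ 7 * (k * k) * M ≤ k ^ 7 * (k * k) * k := by gcongr
        _ = _ := by ring
    refine (Good.add hM q1 q2).mono ?_
    calc k ^ 6 * k ^ 10 * M ≤ k ^ 6 * k ^ 10 * k := by gcongr
      _ = _ := by ring
  intro s hs
  obtain ⟨a, ha, b, hb, rfl | rfl⟩ := h s hs
  · exact fin a ha b hb _ g2'
  · exact fin a ha b hb _ g3

/-- few good elements -/
lemma good_bound {p : ℕ} [Fact p.Prime] {V : Finset (ZMod p)} {k : ℝ} (hk : 0 ≤ k)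
    (hV : k + 1 ≤ #V) (S : Finset (ZMod p)) (hS : ∀ s ∈ S, Good V k s) :
    (#S : ℝ) ≤ #((V - V) - (V - V)) * (k + 1) ^ 2 := by
  classical
  set n := ⌊k⌋₊ + 1 with hn
  have hn1 : k < n := by
    rw [hn]; push_cast; exact Nat.lt_floor_add_one k
  have hn2 : (n : ℝ) ≤ k + 1 := by
    rw [hn]; push_cast; linarith [Nat.floor_le hk]
  have hnV : n ≤ #V := by exact_mod_cast hn2.trans hV
  obtain ⟨V0, hV0, hV0c⟩ := exists_subset_card_eq hnV
  have key : ∀ s ∈ S, ∃ v ∈ V0, ∃ v' ∈ V0, v ≠ v' ∧ s * (v - v') ∈ (V - V) - (V - V) := by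
    intro s hs
    obtain ⟨F, hF, hsub⟩ := hS s hs
    have hlt : #F < #V0 := by
      rw [hV0c]; exact_mod_cast hF.trans_lt hn1
    have hc : ∀ v, v ∈ V0 → ∃ f, f ∈ F ∧ s * v - f ∈ V - V := by
      intro v hv
      obtain ⟨f, hf, d, hd, e⟩ := mem_add.1 (hsub (smul_mem_smul_finset (hV0 hv)))
      refine ⟨f, hf, ?_⟩
      have : s * v - f = d := by
        rw [smul_eq_mul] at e
        linear_combination -e
      rwa [this]
    choose! f hf1 hf2 using hc
    obtain ⟨v, hv, v', hv', hne, he⟩ := exists_ne_map_eq_of_card_lt_of_maps_to hlt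
      (f := f) (fun v hv => hf1 v hv)
    refine ⟨v, hv, v', hv', hne, ?_⟩
    have : s * (v - v') = (s * v - f v) - (s * v' - f v') := by rw [he]; ring
    rw [this]
    exact sub_mem_sub (hf2 v hv) (hf2 v' hv')
  choose! v hv v' hv' hne hd using key
  have hcard : #S ≤ #(((V - V) - (V - V)) ×ˢ (V0 ×ˢ V0)) := by
    apply card_le_card_of_injOn (fun s => (s * (v s - v' s), (v s, v' s)))
    · intro s hs
      simp only [mem_coe, mem_product]
      exact ⟨hd s hs, hv s hs, hv' s hs⟩
    · intro s hs t ht h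
      simp only [Prod.mk.injEq] at h
      obtain ⟨h1, h2, h3⟩ := h
      rw [← h2, ← h3] at h1
      exact mul_right_cancel₀ (sub_ne_zero.2 (hne s hs)) h1
  rw [card_product, card_product, hV0c] at hcard
  calc (#S : ℝ) ≤ #((V - V) - (V - V)) * (n * n) := by exact_mod_cast hcard
    _ ≤ #((V - V) - (V - V)) * ((k + 1) * (k + 1)) := by gcongr
    _ = _ := by ring

lemma ring_bound {p : ℕ} [Fact p.Prime] (V X : Finset (ZMod p)) (hV : V.Nonempty) (Ω : ℝ)
    (hΩ : 1 ≤ Ω) (hX0 : ∀ ξ ∈ X, ξ ≠ 0) (hX : ∀ ξ ∈ X, (#(V - ξ • V) : ℝ) ≤ Ω * #V)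
    (h2 : 2 ≤ #X) (h8 : #X ^ 8 < p) (hK : Ω ^ 49130 + 1 ≤ #V) :
    (#X : ℝ) ^ 8 ≤ 128 * (Ω ^ 8 * #V * (Ω ^ 49130 + 1) ^ 2) := by
  have hVpos : (0 : ℝ) < #V := by exact_mod_cast hV.card_pos
  have hΩ0 : 0 ≤ Ω := by linarith
  obtain ⟨ξ0, hξ0⟩ : X.Nonempty := card_pos.1 (by omega)
  have hVV : (#(V - V) : ℝ) ≤ Ω ^ 2 * #V := by
    have hr := Finset.ruzsa_triangle_inequality_sub_sub_sub V (ξ0 • V) V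
    rw [card_smul_finset₀ (hX0 _ hξ0)] at hr
    have hr' : (#(V - V) : ℝ) * #V ≤ #(V - ξ0 • V) * #(V - ξ0 • V) := by exact_mod_cast hr
    refine le_of_mul_le_mul_right ?_ hVpos
    calc (#(V - V) : ℝ) * #V ≤ #(V - ξ0 • V) * #(V - ξ0 • V) := hr'
      _ ≤ (Ω * #V) * (Ω * #V) := by
        gcongr
        · exact hX _ hξ0
        · exact hX _ hξ0
      _ = _ := by ring
  have hpl : ∀ m n : ℕ, (#(m • V - n • V) : ℝ) ≤ (Ω ^ 2) ^ (m + n) * #V := by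
    intro m n
    have h := pluennecke_ruzsa_inequality_nsmul_sub_nsmul_sub hV V m n
    have h' : (#(m • V - n • V) : ℝ) ≤ ((#(V - V) : ℝ) / #V) ^ (m + n) * #V := by
      have := (NNRat.cast_le (K := ℝ)).2 h
      push_cast at this
      exact this
    refine h'.trans ?_
    gcongr
    rwa [div_le_iff₀ hVpos]
  have e22 : (V - V) - (V - V) = 2 • V - 2 • V := by
    rw [two_nsmul]
    simp only [sub_eq_add_neg, neg_add_rev, neg_neg]
    ac_rfl
  have hDD : (#((V - V) - (V - V)) : ℝ) ≤ Ω ^ 8 * #V := by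
    rw [e22]
    refine (hpl 2 2).trans (le_of_eq ?_)
    ring
  have hCov : Cov V (Ω ^ 10) := by
    have h32 : (#(((V - V) - (V - V)) + V) : ℝ) ≤ Ω ^ 10 * #V := by
      have e : ((V - V) - (V - V)) + V = 3 • V - 2 • V := by
        have e3 : 3 • V = 2 • V + V := succ_nsmul V 2
        rw [e22, e3]
        simp only [sub_eq_add_neg]
        ac_rfl
      rw [e]
      refine (hpl 3 2).trans (le_of_eq ?_)
      ring
    obtain ⟨F, _, hF, hF2⟩ := ruzsa_covering_add hV h32
    refine ⟨F, hF, ?_⟩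
    intro a ha b hb
    constructor
    · apply hF2
      have : a + b = a - (-b) := by ring
      rw [this]
      refine sub_mem_sub ha ?_
      have := neg_mem_neg hb
      rwa [neg_sub] at this
    · exact hF2 (sub_mem_sub ha hb)
  have hgood : ∀ x ∈ X, Good V (Ω ^ 10) x := by
    intro x hx
    have h1 : (#(x • V + (-V)) : ℝ) ≤ Ω * #(-V) := by
      rw [card_neg, ← sub_eq_add_neg, ← neg_sub, card_neg]
      exact hX x hx
    obtain ⟨F, _, hF, hF2⟩ := ruzsa_covering_add hV.neg h1
    refine ⟨F, hF.trans (le_self_pow₀ hΩ (by norm_num)), ?_⟩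
    have : -V - -V = V - V := by
      simp only [sub_eq_add_neg, neg_neg]
      ac_rfl
    rwa [this] at hF2
  have hM1 : 1 ≤ Ω ^ 10 := one_le_pow₀ hΩ
  have hk1 : Ω ^ 10 ≤ (Ω ^ 10) ^ 17 := le_self_pow₀ hM1 (by norm_num)
  have hk2 : Ω ^ 10 ≤ ((Ω ^ 10) ^ 17) ^ 17 := hk1.trans (le_self_pow₀ (hM1.trans hk1) (by norm_num))
  have hpos8 : #X ^ 2 ≤ #X ^ 8 := Nat.pow_le_pow_right (by omega) (by norm_num)
  obtain ⟨S1, a1, b1, g1⟩ := pivot_good hCov hM1 le_rfl X h2 (by omega) hgood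
  have c1 : 2 ≤ #S1 := by nlinarith
  have d1 : #S1 ^ 2 ≤ #X ^ 4 := by
    calc #S1 ^ 2 ≤ (#X ^ 2) ^ 2 := Nat.pow_le_pow_left b1 2
      _ = _ := by ring
  have hpos84 : #X ^ 4 ≤ #X ^ 8 := Nat.pow_le_pow_right (by omega) (by norm_num)
  obtain ⟨S2, a2, b2, g2⟩ := pivot_good hCov hM1 hk1 S1 c1 (by omega) g1
  have c2 : 2 ≤ #S2 := by nlinarith
  have d2 : #S2 ^ 2 ≤ #X ^ 8 := by
    calc #S2 ^ 2 ≤ (#X ^ 4) ^ 2 := Nat.pow_le_pow_left (b2.trans d1) 2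
      _ = _ := by ring
  obtain ⟨S3, a3, b3, g3⟩ := pivot_good hCov hM1 hk2 S2 c2 (by omega) g2
  have hkeq : (((Ω ^ 10) ^ 17) ^ 17) ^ 17 = Ω ^ 49130 := by
    rw [← pow_mul, ← pow_mul, ← pow_mul]
  rw [hkeq] at g3
  have hb := good_bound (by positivity) hK S3 g3
  have hX8 : #X ^ 8 ≤ 128 * #S3 := by
    have : #X ^ 8 ≤ (2 * #S1) ^ 4 := by
      calc #X ^ 8 = (#X ^ 2) ^ 4 := by ring
        _ ≤ _ := Nat.pow_le_pow_left a1 4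
    have h' : #S1 ^ 4 ≤ (2 * #S2) ^ 2 := by
      calc #S1 ^ 4 = (#S1 ^ 2) ^ 2 := by ring
        _ ≤ _ := Nat.pow_le_pow_left a2 2
    nlinarith
  calc (#X : ℝ) ^ 8 ≤ 128 * #S3 := by exact_mod_cast hX8
    _ ≤ 128 * (#((V - V) - (V - V)) * (Ω ^ 49130 + 1) ^ 2) := by gcongr
    _ ≤ _ := by gcongr

end SP

namespace SP
open Finset
open scoped Pointwise

lemma pig (f : ℕ → ℝ) (T : ℝ) (hT : 0 < T) (J : ℕ) (hJ : 0 < J) (h1 : 1 ≤ f J)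
    (h0 : f 0 ≤ T ^ J) : ∃ j < J, f j ≤ T * f (j + 1) := by
  by_contra hc
  push Not at hc
  have : ∀ j ≤ J, T ^ j * f j ≤ f 0 ∧ (0 < j → T ^ j * f j < f 0) := by
    intro j
    induction j with
    | zero => intro _; simp
    | succ i ih =>
      intro hi
      have h2 := (ih (by omega)).1
      have h3 := hc i (by omega)
      have h4 : T ^ (i + 1) * f (i + 1) < T ^ i * f i := by
        have : 0 < T ^ i := by positivity
        calc T ^ (i + 1) * f (i + 1) = T ^ i * (T * f (i + 1)) := by ring
          _ < _ := by gcongr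
      exact ⟨by linarith, fun _ => by linarith⟩
  have h5 := (this J le_rfl).2 hJ
  have : 0 < T ^ J := by positivity
  nlinarith

lemma params : ∃ J I N v w u δ : ℕ, 0 < I ∧ 0 < J ∧ J + I ≤ N ∧
    16 * 10 ^ (J + I) + 64 * 10 ^ N ≤ v * I ∧ 100 * 10 ^ (J + I) + 4 * v ≤ w ∧
    w ≤ 8 * 10 ^ N ∧ 3 ^ J * w + 64 * 10 ^ N ≤ u * J ∧ 2 + 3 ^ J * w + u ≤ δ ∧
    1000000 * δ ≤ 8 * 10 ^ N := by
  obtain ⟨J, hJ⟩ : ∃ J : ℕ, J = 10000000 := ⟨_, rfl⟩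
  obtain ⟨I, hI⟩ : ∃ I : ℕ, I = 10 ^ 11 * 10 ^ J := ⟨_, rfl⟩
  set Q := 10 ^ (2 * J + I) with hQ
  have hQ1 : 1 ≤ Q := Nat.one_le_pow _ _ (by norm_num)
  have hN : 10 ^ (2 * J + I + 11) = 10 ^ 11 * Q := by rw [pow_add, hQ]; ring
  have hQ2 : Q = 10 ^ J * 10 ^ (J + I) := by rw [hQ, ← pow_add]; congr 1; ring
  have hJ1 : 1 ≤ 10 ^ J := Nat.one_le_pow _ _ (by norm_num)
  have h3 : 3 ^ J ≤ 10 ^ J := Nat.pow_le_pow_left (by norm_num) J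
  set P := 10 ^ (J + I) with hP
  have hP1 : 1 ≤ P := Nat.one_le_pow _ _ (by norm_num)
  have hPQ : P ≤ Q := by rw [hQ2]; nlinarith
  have h3w : 3 ^ J * (420 * P) ≤ 420 * Q := by rw [hQ2]; nlinarith
  refine ⟨J, I, 2 * J + I + 11, 80 * P, 420 * P, 640001 * Q, 640424 * Q, ?_, by omega, by omega,
    ?_, by omega, ?_, ?_, ?_, ?_⟩
  · rw [hI]; positivity
  · rw [hN, hQ2]
    have e : 80 * P * I = 80 * P * (10 ^ 11 * 10 ^ J) := congrArg (fun z => 80 * P * z) hI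
    rw [e]
    clear_value P Q
    generalize 10 ^ J = Y at *
    nlinarith [Nat.mul_le_mul hP1 hJ1, Nat.mul_le_mul_left P hJ1]
  · rw [hN]; omega
  · rw [hN]
    refine (Nat.add_le_add_right h3w _).trans ?_
    rw [hJ]
    omega
  · omega
  · rw [hN]; omega

/-- part 1: many popular differences -/
lemma many_add {p : ℕ} [Fact p.Prime] (J I N v w : ℕ) (hI : 0 < I) (hN : J + I ≤ N)
    (hv : 16 * 10 ^ (J + I) + 64 * 10 ^ N ≤ v * I) (hw : 100 * 10 ^ (J + I) + 4 * v ≤ w)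
    (hwN : w ≤ 8 * 10 ^ N)
    (A0 : Finset (ZMod p)) (h0 : (0 : ZMod p) ∉ A0) (t : ℝ) (ht : 2 ≤ t)
    (hn : t ^ (64 * 10 ^ N) = (#A0 : ℝ))
    (H1 : ∀ j ≤ N, ∀ B ⊆ A0, (#A0 : ℝ) ≤ t ^ (2 * 10 ^ j) * #B →
      ∃ X : Finset (ZMod p), t ^ (16 * 10 ^ N) ≤ #X ∧ X ⊆ MS (t ^ (16 * 10 ^ j)) B)
    (H2 : ∀ j ≤ N, ∀ B ⊆ A0, (#A0 : ℝ) ≤ t ^ (2 * 10 ^ j) * #B →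
      ∃ μ : ZMod p, μ ≠ 1 ∧ μ ≠ 0 ∧
        (#B : ℝ) ≤ t ^ (16 * 10 ^ j) * #(B.filter (fun b => μ * (b + 1) - 1 ∈ B)))
    (B : Finset (ZMod p)) (hB : B ⊆ A0) (hBd : (#A0 : ℝ) ≤ t ^ (2 * 10 ^ J) * #B) :
    t ^ (8 * 10 ^ N) ≤ #(AS (t ^ w) B) := by
  have ht1 : 1 ≤ t := by linarith
  have ht0 : 0 < t := by linarith
  have hA0pos : (0 : ℝ) < #A0 := by rw [← hn]; positivity
  have hBpos : (0 : ℝ) < #B := by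
    by_contra hc
    push Not at hc
    have : 0 < t ^ (2 * 10 ^ J) := by positivity
    nlinarith
  have hBne : B.Nonempty := card_pos.1 (by exact_mod_cast hBpos)
  have hB0 : (0 : ZMod p) ∉ B := fun h => h0 (hB h)
  have hBA : (#B : ℝ) ≤ t ^ (64 * 10 ^ N) := by
    rw [hn]; exact_mod_cast card_le_card hB
  obtain ⟨X, hXc, hX⟩ := H1 J (by omega) B hB hBd
  have hMSlow : ∀ i, t ^ (16 * 10 ^ N) ≤ (#(MS (t ^ (16 * 10 ^ (J + i))) B) : ℝ) := by
    intro i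
    refine hXc.trans ?_
    have : X ⊆ MS (t ^ (16 * 10 ^ (J + i))) B := by
      refine hX.trans (MS_mono ?_ B)
      apply pow_le_pow_right₀ ht1
      have : 10 ^ J ≤ 10 ^ (J + i) := Nat.pow_le_pow_right (by norm_num) (by omega)
      omega
    exact_mod_cast card_le_card this
  obtain ⟨j, hj, hjle⟩ := pig (fun i => (#(MS (t ^ (16 * 10 ^ (J + (I - i)))) B) : ℝ)) (t ^ v)
    (by positivity) I hI (by
      refine le_trans ?_ (hMSlow (I - I))
      exact one_le_pow₀ ht1) (by
      refine (card_MS_le (by positivity) B hB0 hBne).trans ?_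
      calc t ^ (16 * 10 ^ (J + (I - 0))) * (#B : ℝ) ≤
          t ^ (16 * 10 ^ (J + (I - 0))) * t ^ (64 * 10 ^ N) := by gcongr
        _ = t ^ (16 * 10 ^ (J + I) + 64 * 10 ^ N) := by rw [← pow_add, Nat.sub_zero]
        _ ≤ t ^ (v * I) := pow_le_pow_right₀ ht1 hv
        _ = _ := by rw [pow_mul])
  obtain ⟨i, hi⟩ : ∃ i, i = I - (j + 1) := ⟨_, rfl⟩
  have hi1 : I - j = i + 1 := by omega
  rw [← hi, hi1] at hjle
  set m := 10 ^ (J + i) with hm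
  have hm1 : 1 ≤ m := Nat.one_le_pow _ _ (by norm_num)
  have hm10 : 10 ^ (J + (i + 1)) = 10 * m := by rw [← add_assoc, pow_succ, hm]; ring
  have hmI : 10 * m ≤ 10 ^ (J + I) := by
    rw [← hm10]
    exact Nat.pow_le_pow_right (by norm_num) (by omega)
  have hJm : 10 ^ J ≤ m := Nat.pow_le_pow_right (by norm_num) (by omega)
  rw [hm10] at hjle
  have h32 : (32 : ℝ) ≤ t ^ 5 := by
    calc (32 : ℝ) = 2 ^ 5 := by norm_num
      _ ≤ _ := by gcongr
  have h128 : (128 : ℝ) ≤ t ^ 7 := by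
    calc (128 : ℝ) = 2 ^ 7 := by norm_num
      _ ≤ _ := by gcongr
  have h8 : (8 : ℝ) ≤ t ^ 3 := by
    calc (8 : ℝ) = 2 ^ 3 := by norm_num
      _ ≤ _ := by gcongr
  have hmain := trans_rich B hBne hB0 (t ^ (16 * m)) (one_le_pow₀ ht1) (t ^ v)
    (t ^ (16 * (10 * m))) (by positivity) (by positivity)
    (by
      have h1 := hMSlow i
      have h2 : (0:ℝ) < t ^ (16 * 10 ^ N) := by positivity
      exact card_pos.1 (by exact_mod_cast h2.trans_le h1))
    (by
      refine le_trans ?_ hjle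
      have : MS (32 * (t ^ (16 * m)) ^ 2) B ⊆ MS (t ^ (16 * (10 * m))) B := by
        apply MS_mono
        calc 32 * (t ^ (16 * m)) ^ 2 ≤ t ^ 5 * (t ^ (16 * m)) ^ 2 := by gcongr
          _ = t ^ (5 + 16 * m * 2) := by rw [← pow_mul, ← pow_add]
          _ ≤ _ := pow_le_pow_right₀ ht1 (by omega)
      exact_mod_cast card_le_card this)
    (by
      intro B1 hB1 hB1c
      have := H2 (J + (i + 1)) (by omega) B1 (hB1.trans hB) (by
        rw [hm10]
        calc (#A0 : ℝ) ≤ t ^ (2 * 10 ^ J) * #B := hBd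
          _ ≤ t ^ (2 * 10 ^ J) * (2 * t ^ (16 * m) * #B1) := by gcongr
          _ ≤ t ^ (2 * 10 ^ J) * (t * t ^ (16 * m) * #B1) := by gcongr
          _ = t ^ (2 * 10 ^ J + (1 + 16 * m)) * #B1 := by
            rw [pow_add t (2 * 10 ^ J), pow_add t 1, pow_one]; ring
          _ ≤ _ := by
            gcongr
            omega)
      rw [hm10] at this
      exact this)
    _ rfl
  set Λ : ℝ := 128 * (t ^ (16 * m)) ^ 5 * t ^ (16 * (10 * m)) * (t ^ v) ^ 2 with hΛ
  have hΛle : Λ ≤ t ^ (7 + 240 * m + 2 * v) := by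
    calc Λ ≤ t ^ 7 * (t ^ (16 * m)) ^ 5 * t ^ (16 * (10 * m)) * (t ^ v) ^ 2 := by
          rw [hΛ]; gcongr
      _ = t ^ (7 + 16 * m * 5 + 16 * (10 * m) + v * 2) := by
          rw [← pow_mul, ← pow_mul, ← pow_add, ← pow_add, ← pow_add]
      _ = _ := by congr 1; ring
  have hΛ0 : 0 < Λ := by positivity
  have hΛ2 : Λ ^ 2 ≤ t ^ (14 + 480 * m + 4 * v) := by
    calc Λ ^ 2 ≤ (t ^ (7 + 240 * m + 2 * v)) ^ 2 := by gcongr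
      _ = _ := by rw [← pow_mul]; congr 1; ring
  have hAS : (#(AS (2 * Λ ^ 2) B) : ℝ) ≤ #(AS (t ^ w) B) := by
    have : AS (2 * Λ ^ 2) B ⊆ AS (t ^ w) B := by
      apply AS_mono
      calc 2 * Λ ^ 2 ≤ t * t ^ (14 + 480 * m + 4 * v) := by gcongr
        _ = t ^ (1 + (14 + 480 * m + 4 * v)) := by rw [pow_add t 1, pow_one]
        _ ≤ _ := pow_le_pow_right₀ ht1 (by omega)
    exact_mod_cast card_le_card this
  have hcoef : 8 * t ^ (16 * m) * Λ ^ 2 ≤ t ^ (8 * 10 ^ N) := by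
    calc 8 * t ^ (16 * m) * Λ ^ 2 ≤ t ^ 3 * t ^ (16 * m) * t ^ (14 + 480 * m + 4 * v) := by gcongr
      _ = t ^ (3 + 16 * m + (14 + 480 * m + 4 * v)) := by rw [← pow_add, ← pow_add]
      _ ≤ _ := pow_le_pow_right₀ ht1 (by omega)
  have hlow := hMSlow i
  rw [← hm] at hlow
  have hT : (0 : ℝ) < t ^ (8 * 10 ^ N) := by positivity
  refine le_of_mul_le_mul_left ?_ hT
  calc t ^ (8 * 10 ^ N) * t ^ (8 * 10 ^ N) = t ^ (16 * 10 ^ N) := by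
        rw [← pow_add]; congr 1; ring
    _ ≤ _ := hlow
    _ ≤ _ := hmain
    _ ≤ 8 * t ^ (16 * m) * Λ ^ 2 * #(AS (t ^ w) B) := by gcongr
    _ ≤ _ := by gcongr

end SP

namespace SP
open Finset
open scoped Pointwise

lemma core {p : ℕ} [Fact p.Prime] (J I N v w u δ : ℕ) (hI : 0 < I) (hJ : 0 < J) (hN : J + I ≤ N)
    (hv : 16 * 10 ^ (J + I) + 64 * 10 ^ N ≤ v * I) (hw : 100 * 10 ^ (J + I) + 4 * v ≤ w)
    (hwN : w ≤ 8 * 10 ^ N) (hu : 3 ^ J * w + 64 * 10 ^ N ≤ u * J)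
    (hδ : 2 + 3 ^ J * w + u ≤ δ) (hδN : 1000000 * δ ≤ 8 * 10 ^ N)
    (A0 : Finset (ZMod p)) (h0 : (0 : ZMod p) ∉ A0) (t : ℝ) (ht : 2 ≤ t)
    (hn : t ^ (64 * 10 ^ N) = (#A0 : ℝ)) (hp : #A0 ^ 2 < p)
    (H1 : ∀ j ≤ N, ∀ B ⊆ A0, (#A0 : ℝ) ≤ t ^ (2 * 10 ^ j) * #B →
      ∃ X : Finset (ZMod p), t ^ (16 * 10 ^ N) ≤ #X ∧ X ⊆ MS (t ^ (16 * 10 ^ j)) B)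
    (H2 : ∀ j ≤ N, ∀ B ⊆ A0, (#A0 : ℝ) ≤ t ^ (2 * 10 ^ j) * #B →
      ∃ μ : ZMod p, μ ≠ 1 ∧ μ ≠ 0 ∧
        (#B : ℝ) ≤ t ^ (16 * 10 ^ j) * #(B.filter (fun b => μ * (b + 1) - 1 ∈ B))) : False := by
  classical
  have ht1 : 1 ≤ t := by linarith
  have ht0 : 0 < t := by linarith
  have hA0pos : (0 : ℝ) < #A0 := by rw [← hn]; positivity
  have hexmin : ∀ j : ℕ, ∃ B ⊆ A0, (#A0 : ℝ) ≤ t ^ (2 * 10 ^ j) * #B ∧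
      ∀ B' ⊆ A0, (#A0 : ℝ) ≤ t ^ (2 * 10 ^ j) * #B' →
        #(AS (t ^ (3 ^ (J - j) * w)) B) ≤ #(AS (t ^ (3 ^ (J - j) * w)) B') := by
    intro j
    obtain ⟨B, hB, hmin⟩ := Finset.exists_min_image
      (A0.powerset.filter (fun B => (#A0 : ℝ) ≤ t ^ (2 * 10 ^ j) * #B))
      (fun B => #(AS (t ^ (3 ^ (J - j) * w)) B))
      ⟨A0, by
        rw [mem_filter, mem_powerset]
        refine ⟨subset_rfl, ?_⟩
        have : 1 ≤ t ^ (2 * 10 ^ j) := one_le_pow₀ ht1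
        nlinarith⟩
    rw [mem_filter, mem_powerset] at hB
    refine ⟨B, hB.1, hB.2, fun B' h1 h2 => hmin B' ?_⟩
    rw [mem_filter, mem_powerset]
    exact ⟨h1, h2⟩
  choose Bf hBf hBd hBmin using hexmin
  have hne : ∀ j, (Bf j).Nonempty := by
    intro j
    rw [← card_pos]
    by_contra hc
    have hz : #(Bf j) = 0 := by omega
    have := hBd j
    rw [hz] at this
    simp at this
    rw [this] at hA0pos
    simp at hA0pos
  have hup : ∀ a : ℕ, a ≤ 3 ^ J * w → ∀ B ⊆ A0, B.Nonempty →
      (#(AS (t ^ a) B) : ℝ) ≤ t ^ (3 ^ J * w + 64 * 10 ^ N) := by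
    intro a ha B hB hBn
    refine (card_AS_le (by positivity) B hBn).trans ?_
    have : (#B : ℝ) ≤ t ^ (64 * 10 ^ N) := by rw [hn]; exact_mod_cast card_le_card hB
    calc t ^ a * (#B : ℝ) ≤ t ^ (3 ^ J * w) * t ^ (64 * 10 ^ N) := by gcongr
      _ = _ := by rw [← pow_add]
  have haJ : ∀ j, 3 ^ (J - j) * w ≤ 3 ^ J * w := by
    intro j
    exact Nat.mul_le_mul_right _ (Nat.pow_le_pow_right (by norm_num) (by omega))
  obtain ⟨j, hj, hjle⟩ := pig (fun j => (#(AS (t ^ (3 ^ (J - j) * w)) (Bf j)) : ℝ)) (t ^ u)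
    (by positivity) J hJ (by
      have : 0 < #(AS (t ^ (3 ^ (J - J) * w)) (Bf J)) :=
        card_pos.2 ⟨0, zero_mem_AS (one_le_pow₀ ht1) _⟩
      exact_mod_cast this) (by
      refine (hup _ (haJ 0) _ (hBf 0) (hne 0)).trans ?_
      rw [← pow_mul]
      exact pow_le_pow_right₀ ht1 hu)
  set B := Bf j with hBdef
  obtain ⟨a, ha⟩ : ∃ a, a = 3 ^ (J - (j + 1)) * w := ⟨_, rfl⟩
  have ha3 : 3 ^ (J - j) * w = 3 * a := by
    rw [ha, show J - j = (J - (j + 1)) + 1 by omega, pow_succ]; ring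
  have haw : w ≤ a := by
    rw [ha]; exact Nat.le_mul_of_pos_left _ (by positivity)
  have h3a : 3 * a ≤ 3 ^ J * w := ha3 ▸ haJ j
  have hm : 10 ^ j ≤ 10 ^ (J + I) := Nat.pow_le_pow_right (by norm_num) (by omega)
  have hm1 : 1 ≤ 10 ^ j := Nat.one_le_pow _ _ (by norm_num)
  rw [ha3, ← ha] at hjle
  have hBA := hBf j
  have hBdj := hBd j
  rw [← hBdef] at hBA hBdj
  have hmin1 := hBmin (j + 1)
  rw [← ha] at hmin1
  obtain ⟨X0, hX0c, hX0⟩ := H1 j (by omega) B hBA hBdj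
  have hX0ne : X0.Nonempty := by
    have h2 : (0:ℝ) < t ^ (16 * 10 ^ N) := by positivity
    exact card_pos.1 (by exact_mod_cast h2.trans_le hX0c)
  have h32 : (32 : ℝ) ≤ t ^ 5 := by
    calc (32 : ℝ) = 2 ^ 5 := by norm_num
      _ ≤ _ := by gcongr
  have h128 : (128 : ℝ) ≤ t ^ 7 := by
    calc (128 : ℝ) = 2 ^ 7 := by norm_num
      _ ≤ _ := by gcongr
  have h4 : (4 : ℝ) ≤ t ^ 2 := by
    calc (4 : ℝ) = 2 ^ 2 := by norm_num
      _ ≤ _ := by gcongr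
  have hlowB : t ^ (8 * 10 ^ N) ≤ (#(AS (t ^ (3 * a)) B) : ℝ) := by
    refine (many_add J I N v w hI hN hv hw hwN A0 h0 t ht hn H1 H2 B hBA ?_).trans ?_
    · refine hBdj.trans ?_
      gcongr
      norm_num
    · have : AS (t ^ w) B ⊆ AS (t ^ (3 * a)) B :=
        AS_mono (pow_le_pow_right₀ ht1 (by omega)) B
      exact_mod_cast card_le_card this
  obtain ⟨V, X, hV, hVAS, hVc, hXne, hXc, hXV⟩ := ring_input B (hne j) (t ^ (3 * a)) (t ^ a)
    (t ^ (16 * 10 ^ j)) (t ^ u) (one_le_pow₀ ht1) (one_le_pow₀ ht1) (by positivity)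
    (by
      calc 32 * (t ^ a) ^ 2 * t ^ (16 * 10 ^ j) ≤ t ^ 5 * (t ^ a) ^ 2 * t ^ (16 * 10 ^ j) := by
            gcongr
        _ = t ^ (5 + a * 2 + 16 * 10 ^ j) := by rw [← pow_mul, ← pow_add, ← pow_add]
        _ ≤ _ := pow_le_pow_right₀ ht1 (by omega))
    X0 hX0ne hX0
    (by
      intro B' hB' hB'c
      refine hjle.trans ?_
      refine mul_le_mul_of_nonneg_left ?_ (by positivity)
      refine Nat.cast_le.2 (hmin1 B' (hB'.trans hBA) ?_)
      calc (#A0 : ℝ) ≤ t ^ (2 * 10 ^ j) * #B := hBdj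
        _ ≤ t ^ (2 * 10 ^ j) * (t ^ (16 * 10 ^ j) * #B') := by gcongr
        _ = t ^ (2 * 10 ^ j + 16 * 10 ^ j) * #B' := by rw [pow_add]; ring
        _ ≤ _ := by
          gcongr
          rw [pow_succ]; omega)
    _ rfl
  set Δ : ℝ := 4 * t ^ a * t ^ u with hΔ
  have hΔ0 : 0 < Δ := by positivity
  have hΔle : Δ ≤ t ^ δ := by
    calc Δ ≤ t ^ 2 * t ^ a * t ^ u := by rw [hΔ]; gcongr
      _ = t ^ (2 + a + u) := by rw [← pow_add, ← pow_add]
      _ ≤ _ := pow_le_pow_right₀ ht1 (by omega)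
  obtain ⟨Mx, hMx⟩ : ∃ M : ℕ, M = 10 ^ N := ⟨_, rfl⟩
  rw [← hMx] at hδN hn hlowB hX0c hup
  have hVup : (#V : ℝ) ≤ t ^ (δ + 64 * Mx) := by
    have h1 : (#V : ℝ) ≤ #(AS (t ^ (3 * a)) B) := by exact_mod_cast card_le_card hVAS
    refine h1.trans ((hup _ h3a B hBA (hne j)).trans ?_)
    exact pow_le_pow_right₀ ht1 (by omega)
  obtain ⟨e1, he1⟩ : ∃ e, δ + e = 8 * Mx := ⟨8 * Mx - δ, by omega⟩
  have hVlow : t ^ e1 ≤ (#V : ℝ) := by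
    refine le_of_mul_le_mul_left ?_ (by positivity : 0 < t ^ δ)
    rw [← pow_add, he1]
    refine hlowB.trans (hVc.trans ?_)
    gcongr
  obtain ⟨b, hb⟩ : ∃ e, (1 + 4 * δ) + (e + 1) = 16 * Mx := ⟨16 * Mx - 4 * δ - 2, by omega⟩
  have hXlow : t ^ (b + 1) ≤ (#X : ℝ) := by
    refine le_of_mul_le_mul_left ?_ (by positivity : 0 < t ^ (1 + 4 * δ))
    rw [← pow_add, hb]
    refine hX0c.trans (hXc.trans ?_)
    calc 2 * Δ ^ 4 * (#X : ℝ) ≤ t * (t ^ δ) ^ 4 * #X := by gcongr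
      _ = _ := by rw [← pow_mul, pow_add, pow_one, mul_comm δ]
  have hs0 : (⌊t ^ (b + 1)⌋₊ : ℕ) ≤ #X := Nat.floor_le_of_le hXlow
  obtain ⟨X', hX'X, hX'c⟩ := Finset.exists_subset_card_eq hs0
  have hX'up : (#X' : ℝ) ≤ t ^ (b + 1) := by
    rw [hX'c]; exact Nat.floor_le (by positivity)
  have hX'low : t ^ b ≤ (#X' : ℝ) := by
    have h1 := Nat.lt_floor_add_one (t ^ (b + 1))
    rw [← hX'c] at h1
    have h2 : 1 ≤ t ^ b := one_le_pow₀ ht1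
    rw [pow_succ] at h1
    nlinarith
  have hX'2 : 2 ≤ #X' := by
    have : (2 : ℝ) ≤ #X' := by
      refine le_trans ?_ hX'low
      calc (2 : ℝ) ≤ t := ht
        _ = t ^ 1 := (pow_one t).symm
        _ ≤ _ := pow_le_pow_right₀ ht1 (by omega)
    exact_mod_cast this
  have hX'8 : #X' ^ 8 < p := by
    refine lt_of_le_of_lt ?_ hp
    have : (#X' : ℝ) ^ 8 ≤ (#A0 : ℝ) ^ 2 := by
      calc (#X' : ℝ) ^ 8 ≤ (t ^ (b + 1)) ^ 8 := by gcongr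
        _ = t ^ ((b + 1) * 8) := by rw [← pow_mul]
        _ ≤ t ^ (64 * Mx * 2) := pow_le_pow_right₀ ht1 (by omega)
        _ = _ := by rw [pow_mul, hn]
    exact_mod_cast this
  obtain ⟨ω, hω⟩ : ∃ ω, ω = 2 + 14 * δ := ⟨_, rfl⟩
  have hΩ : ∀ ξ ∈ X', (#(V - ξ • V) : ℝ) ≤ t ^ ω * #V := by
    intro ξ hξ
    refine (hXV ξ (hX'X hξ)).trans ?_
    gcongr
    calc 4 * Δ ^ 14 ≤ t ^ 2 * (t ^ δ) ^ 14 := by gcongr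
      _ = _ := by rw [← pow_mul, ← pow_add, hω, mul_comm δ]
  have hK : (t ^ ω) ^ 49130 + 1 ≤ t ^ (ω * 49130 + 1) := by
    have h2 : 1 ≤ t ^ (ω * 49130) := one_le_pow₀ ht1
    rw [← pow_mul, pow_succ]
    nlinarith
  have hfin := ring_bound V X' hV (t ^ ω) (one_le_pow₀ ht1) (fun ξ h => hXne ξ (hX'X h)) hΩ hX'2
    hX'8 (hK.trans ((pow_le_pow_right₀ ht1 (by omega)).trans hVlow))
  have hlt : t ^ (b * 8) < t ^ (b * 8) := by
    calc t ^ (b * 8) = (t ^ b) ^ 8 := by rw [pow_mul]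
      _ ≤ (#X' : ℝ) ^ 8 := by gcongr
      _ ≤ _ := hfin
      _ ≤ t ^ 7 * ((t ^ ω) ^ 8 * t ^ (δ + 64 * Mx) * (t ^ (ω * 49130 + 1)) ^ 2) := by gcongr
      _ = t ^ (7 + (ω * 8 + (δ + 64 * Mx) + (ω * 49130 + 1) * 2)) := by
        rw [← pow_mul, ← pow_mul, ← pow_add, ← pow_add, ← pow_add]
      _ < _ := pow_lt_pow_right₀ (by linarith) (by omega)
  exact lt_irrefl _ hlt

end SP

namespace SP
open Finset
open scoped Pointwise

lemma mono_sidon {p : ℕ} {K K' : ℝ} (h : K ≤ K') {S : Finset (ZMod p)} (hS : IsMulSidon K S) :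
    IsMulSidon K' S := fun l hl => (hS l hl).trans h

open Classical in
lemma rich_count {p : ℕ} [Fact p.Prime] (N j : ℕ) (hj : j ≤ N) (t : ℝ) (ht : 2 ≤ t)
    (n : ℝ) (hn : t ^ (64 * 10 ^ N) = n)
    (B : Finset (ZMod p)) (h0 : (0 : ZMod p) ∉ B) (hBn : (#B : ℝ) ≤ n)
    (hBd : n ≤ t ^ (2 * 10 ^ j) * #B)
    (hno : ∀ S ⊆ B, IsMulSidon (12 * 10 ^ N : ℝ) S → (#S : ℝ) < t ^ (32 * 10 ^ N + 1) / 8) :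
    t ^ (16 * 10 ^ N) ≤ (#((univ : Finset (ZMod p)).filter
      (fun l => l ≠ 0 ∧ l ≠ 1 ∧ (#B : ℝ) ≤ t ^ (16 * 10 ^ j) * mr B l)) : ℝ) := by
  have ht1 : 1 ≤ t := by linarith
  by_contra hc
  push Not at hc
  obtain ⟨i, rfl⟩ : ∃ i, N = j + i := ⟨N - j, by omega⟩
  have e : ∀ c : ℕ, (t ^ (10 ^ j)) ^ (c * (4 * 10 ^ i)) = t ^ (c * 4 * 10 ^ (j + i)) := by
    intro c
    rw [← pow_mul, pow_add]; congr 1; ring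
  have hi1 : 1 ≤ 10 ^ i := Nat.one_le_pow _ _ (by norm_num)
  have hj1 : 1 ≤ 10 ^ j := Nat.one_le_pow _ _ (by norm_num)
  obtain ⟨S, hSB, hS, hSc⟩ := sidon_subset (4 * 10 ^ i) (by omega) (t ^ (10 ^ j))
    (one_le_pow₀ ht1) B h0 (by rw [e, hn]; exact hBn)
    (by rw [e, hn, ← pow_mul, mul_comm _ 2]; exact hBd)
    (by rw [e, ← pow_mul, mul_comm _ 16]; exact hc)
  have h1 := hno S hSB (mono_sidon (by
    push_cast
    have : (10:ℝ) ^ i ≤ 10 ^ (j + i) := pow_le_pow_right₀ (by norm_num) (by omega)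
    linarith) hS)
  have h2 : t ^ (32 * 10 ^ (j + i) + 1) ≤ (t ^ (10 ^ j)) ^ (8 * (4 * 10 ^ i) + 1) := by
    rw [pow_succ (t ^ 10 ^ j), e, ← pow_add]
    exact pow_le_pow_right₀ ht1 (by omega)
  linarith

lemma big_case {p : ℕ} [Fact p.Prime] (J I N v w u δ : ℕ) (hI : 0 < I) (hJ : 0 < J) (hN : J + I ≤ N)
    (hv : 16 * 10 ^ (J + I) + 64 * 10 ^ N ≤ v * I) (hw : 100 * 10 ^ (J + I) + 4 * v ≤ w)
    (hwN : w ≤ 8 * 10 ^ N) (hu : 3 ^ J * w + 64 * 10 ^ N ≤ u * J)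
    (hδ : 2 + 3 ^ J * w + u ≤ δ) (hδN : 1000000 * δ ≤ 8 * 10 ^ N)
    (A0 : Finset (ZMod p)) (h0 : (0 : ZMod p) ∉ A0) (hm1 : (-1 : ZMod p) ∉ A0)
    (t : ℝ) (ht : 2 ≤ t)
    (hn : t ^ (64 * 10 ^ N) = (#A0 : ℝ)) (hp : #A0 ^ 2 < p) :
    ∃ S, (S ⊆ A0 ∨ S ⊆ A0.image (· + 1)) ∧ IsMulSidon (12 * 10 ^ N : ℝ) S ∧
      t ^ (32 * 10 ^ N + 1) / 8 ≤ #S := by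
  classical
  by_contra hc
  push Not at hc
  refine core J I N v w u δ hI hJ hN hv hw hwN hu hδ hδN A0 h0 t ht hn hp ?_ ?_
  · intro j hj B hB hBd
    refine ⟨_, rich_count N j hj t ht _ hn B (fun h => h0 (hB h))
      (by exact_mod_cast card_le_card hB) hBd (fun S hS => hc S (Or.inl (hS.trans hB))), ?_⟩
    intro l hl
    rw [mem_filter] at hl
    rw [mem_MS]
    exact ⟨hl.2.1, hl.2.2.2⟩
  · intro j hj B hB hBd
    have hci : #(B.image (· + 1)) = #B := card_image_of_injective _ (add_left_injective 1)
    have h := rich_count N j hj t ht _ hn (B.image (· + 1))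
      (by
        intro h
        rw [mem_image] at h
        obtain ⟨b, hb, hb1⟩ := h
        apply hm1
        rw [← eq_neg_of_add_eq_zero_left hb1]
        exact hB hb)
      (by rw [hci]; exact_mod_cast card_le_card hB) (by rw [hci]; exact hBd)
      (fun S hS => hc S (Or.inr (hS.trans (image_subset_image hB))))
    have hpos : (0 : ℝ) < t ^ (16 * 10 ^ N) := by positivity
    obtain ⟨μ, hμ⟩ := card_pos.1 (by exact_mod_cast hpos.trans_le h)
    rw [mem_filter] at hμ
    obtain ⟨-, hμ0, hμ1, hμ⟩ := hμ
    refine ⟨μ, hμ1, hμ0, ?_⟩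
    rw [hci] at hμ
    refine hμ.trans ?_
    gcongr
    unfold mr
    refine le_trans (card_le_card ?_) (card_image_le (s := B.filter (fun b => μ * (b + 1) - 1 ∈ B))
      (f := (· + 1)))
    intro y hy
    simp only [mem_filter, mem_image] at hy ⊢
    obtain ⟨⟨b, hb, rfl⟩, ⟨b', hb', he⟩⟩ := hy
    refine ⟨b, ⟨hb, ?_⟩, rfl⟩
    rw [← he, add_sub_cancel_right]
    exact hb'

end SP

theorem stmt7 :
    ∃ c K c0 : ℝ, 0 < c ∧ 1 ≤ K ∧ 0 < c0 ∧
      ∀ (p : ℕ) [Fact p.Prime],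
        ∀ A : Finset (ZMod p), (A.card : ℝ) < Real.sqrt p →
          ∃ S : Finset (ZMod p),
            (S ⊆ A ∨ S ⊆ A.image (· + 1)) ∧ IsMulSidon K S ∧
            c0 * (A.card : ℝ) ^ ((1 : ℝ) / 2 + c) ≤ S.card := by
  classical
  obtain ⟨J, I, N, v, w, u, δ, hI, hJ, hN, hv, hw, hwN, hu, hδ, hδN⟩ := SP.params
  have hTpos : 1 ≤ 10 ^ N := Nat.one_le_pow _ _ (by norm_num)
  have hTR : (1 : ℝ) ≤ (10 : ℝ) ^ N := one_le_pow₀ (by norm_num)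
  obtain ⟨M, hM⟩ : ∃ M : ℕ, M = 64 * 10 ^ N := ⟨_, rfl⟩
  have hM64 : 64 ≤ M := by omega
  have hMR : (64 : ℝ) ≤ M := by exact_mod_cast hM64
  refine ⟨1 / M, 12 * 10 ^ N, 1 / (2 ^ M + 16), by positivity, by linarith, by positivity, ?_⟩
  intro p _ A hA
  have h2M : (0 : ℝ) < 2 ^ M := by positivity
  have hexp : (1 : ℝ) / 2 + 1 / M ≤ 1 := by
    have : (1 : ℝ) / M ≤ 1 / 64 := one_div_le_one_div_of_le (by norm_num) hMR
    linarith
  have hexp0 : (0 : ℝ) < 1 / 2 + 1 / M := by positivity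
  rcases A.eq_empty_or_nonempty with hAe | ⟨a, haA⟩
  · refine ⟨∅, Or.inl (Finset.empty_subset _), ?_, ?_⟩
    · intro l _
      have := SP.mulPairCount_le (∅ : Finset (ZMod p)) l
      have h0 : mulPairCount l (∅ : Finset (ZMod p)) = 0 := by
        simpa [SP.mr] using this
      rw [h0]; push_cast; linarith
    · rw [hAe]
      simp only [Finset.card_empty, Nat.cast_zero]
      rw [Real.zero_rpow hexp0.ne', mul_zero]
  set A0 := (A.erase 0).erase (-1) with hA0
  have hA0A : A0 ⊆ A := (Finset.erase_subset _ _).trans (Finset.erase_subset _ _)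
  have hcard : A.card ≤ A0.card + 2 := by
    have h1 := Finset.pred_card_le_card_erase (s := A) (a := 0)
    have h2 := Finset.pred_card_le_card_erase (s := A.erase 0) (a := -1)
    rw [← hA0] at h2
    omega
  have hA1 : (1 : ℝ) ≤ A.card := by
    exact_mod_cast Finset.card_pos.2 ⟨a, haA⟩
  have hcR : (A.card : ℝ) ≤ A0.card + 2 := by exact_mod_cast hcard
  by_cases hbig : (2 : ℝ) ^ M ≤ A0.card
  · obtain ⟨t, ht⟩ : ∃ t : ℝ, t = (A0.card : ℝ) ^ ((1 : ℝ) / M) := ⟨_, rfl⟩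
    have hM0 : M ≠ 0 := by omega
    have htM : t ^ M = A0.card := by
      rw [ht, one_div]
      exact Real.rpow_inv_natCast_pow (by positivity) hM0
    have ht0 : 0 ≤ t := by rw [ht]; positivity
    have ht2 : 2 ≤ t := by
      rw [← htM] at hbig
      exact le_of_pow_le_pow_left₀ hM0 ht0 hbig
    have hp : A0.card ^ 2 < p := by
      have h1 : (A.card : ℝ) ^ 2 < p := by
        rw [Real.lt_sqrt (by positivity)] at hA
        exact hA
      have h2 : A.card ^ 2 < p := by exact_mod_cast h1
      exact lt_of_le_of_lt (Nat.pow_le_pow_left (Finset.card_le_card hA0A) 2) h2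
    obtain ⟨S, hS, hSid, hSc⟩ := SP.big_case J I N v w u δ hI hJ hN hv hw hwN hu hδ hδN A0
      (by simp [hA0]) (by simp [hA0]) t ht2 (by rw [← hM]; exact htM) hp
    refine ⟨S, ?_, hSid, ?_⟩
    · rcases hS with h | h
      · exact Or.inl (h.trans hA0A)
      · exact Or.inr (h.trans (Finset.image_subset_image hA0A))
    · refine le_trans ?_ hSc
      have hpow : (A0.card : ℝ) ^ ((1 : ℝ) / 2 + 1 / M) = t ^ (32 * 10 ^ N + 1) := by
        rw [← htM, ← Real.rpow_natCast t M, ← Real.rpow_mul ht0, ← Real.rpow_natCast]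
        congr 1
        have : (M : ℝ) = 64 * 10 ^ N := by rw [hM]; push_cast; ring
        rw [mul_add, mul_one_div_cancel (by positivity), this]
        push_cast
        ring
      have h4 : (2 : ℝ) ≤ A0.card := by
        refine le_trans ?_ hbig
        calc (2 : ℝ) = 2 ^ 1 := by norm_num
          _ ≤ 2 ^ M := pow_le_pow_right₀ (by norm_num) (by omega)
      have h5 : (A.card : ℝ) ^ ((1 : ℝ) / 2 + 1 / M) ≤ 2 * t ^ (32 * 10 ^ N + 1) := by
        calc (A.card : ℝ) ^ ((1 : ℝ) / 2 + 1 / M) ≤ (2 * A0.card : ℝ) ^ ((1 : ℝ) / 2 + 1 / M) := by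
              apply Real.rpow_le_rpow (by positivity) (by linarith) hexp0.le
          _ = 2 ^ ((1 : ℝ) / 2 + 1 / M) * (A0.card : ℝ) ^ ((1 : ℝ) / 2 + 1 / M) :=
              Real.mul_rpow (by norm_num) (by positivity)
          _ ≤ 2 ^ (1 : ℝ) * (A0.card : ℝ) ^ ((1 : ℝ) / 2 + 1 / M) := by
              gcongr
              norm_num
          _ = _ := by rw [hpow, Real.rpow_one]
      have h6 : (1 : ℝ) / (2 ^ M + 16) ≤ 1 / 16 :=
        one_div_le_one_div_of_le (by norm_num) (by linarith)
      have h7 : (0 : ℝ) ≤ t ^ (32 * 10 ^ N + 1) := by positivity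
      calc 1 / (2 ^ M + 16) * (A.card : ℝ) ^ ((1 : ℝ) / 2 + 1 / M) ≤
          1 / 16 * (2 * t ^ (32 * 10 ^ N + 1)) := by gcongr
        _ = _ := by ring
  · push Not at hbig
    refine ⟨{a}, Or.inl (by simpa using haA), ?_, ?_⟩
    · intro l _
      have h1 := SP.mulPairCount_le ({a} : Finset (ZMod p)) l
      have h2 : SP.mr ({a} : Finset (ZMod p)) l ≤ 1 := by
        unfold SP.mr
        exact (Finset.card_filter_le _ _).trans (by simp)
      have h3 : (mulPairCount l ({a} : Finset (ZMod p)) : ℝ) ≤ 1 := by exact_mod_cast h1.trans h2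
      linarith
    · have h1 : (A.card : ℝ) ^ ((1 : ℝ) / 2 + 1 / M) ≤ (A.card : ℝ) ^ (1 : ℝ) :=
        Real.rpow_le_rpow_of_exponent_le hA1 hexp
      rw [Real.rpow_one] at h1
      rw [Finset.card_singleton, one_div_mul_eq_div, div_le_iff₀ (by positivity)]
      push_cast
      linarith
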